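/- arXiv:2602.11991 — 2 statements merged into one kernel-verified Lean document; each statement's English description precedes it below -/
import Mathlib

section
/- Let n ≥ 1, R > 0 and let u be a function on B_R(0) ⊂ ℝⁿ that is C¹ on B_R(0) and C³ on B_R(0) ∩ {|∇u| > 0}, and that satisfies the minimal surface equation div(∇u/√(1+|∇u|²)) = 0 on B_R(0). Set L = sup_{x,y ∈ B_R(0)} |u(x) − u(y)|. Then there exists a constant C > 0 depending only on n such that |∇u(0)|² ≤ max{ exp(C L² / R²) − 1 , exp(C L / R) − 1 }. -/
open Metric Real Filter

noncomputable def pd1 {n : ℕ} (u : EuclideanSpace ℝ (Fin n) → ℝ) (i : Fin n)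
    (x : EuclideanSpace ℝ (Fin n)) : ℝ :=
  fderiv ℝ u x (EuclideanSpace.single i 1)

noncomputable def pd2 {n : ℕ} (u : EuclideanSpace ℝ (Fin n) → ℝ) (i j : Fin n)
    (x : EuclideanSpace ℝ (Fin n)) : ℝ :=
  fderiv ℝ (pd1 u j) x (EuclideanSpace.single i 1)

/-- The coefficients `a^{ij} = δ^{ij} - u_i u_j / (1 + |∇u|²)` of the
nondivergence form of the mean curvature operator. -/
noncomputable def aCoef {n : ℕ} (u : EuclideanSpace ℝ (Fin n) → ℝ) (i j : Fin n)
    (x : EuclideanSpace ℝ (Fin n)) : ℝ :=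
  (if i = j then (1 : ℝ) else 0) - pd1 u i x * pd1 u j x / (1 + ‖gradient u x‖ ^ 2)

/-- The mean curvature operator in nondivergence form: `a^{ij} u_{ij}`. -/
noncomputable def mcOp {n : ℕ} (u : EuclideanSpace ℝ (Fin n) → ℝ)
    (x : EuclideanSpace ℝ (Fin n)) : ℝ :=
  ∑ i, ∑ j, aCoef u i j x * pd2 u i j x

section PartialDerivatives

variable {n : ℕ} {f g : EuclideanSpace ℝ (Fin n) → ℝ} {x : EuclideanSpace ℝ (Fin n)}

theorem HasFDerivAt.pd1_eq {f' : EuclideanSpace ℝ (Fin n) →L[ℝ] ℝ} (h : HasFDerivAt f f' x)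
    (i : Fin n) : pd1 f i x = f' (EuclideanSpace.single i 1) := by
  rw [pd1, h.fderiv]

theorem Filter.EventuallyEq.pd1_eq (h : f =ᶠ[nhds x] g) (i : Fin n) : pd1 f i x = pd1 g i x := by
  rw [pd1, pd1, h.fderiv_eq]

theorem pd1_add (hf : DifferentiableAt ℝ f x) (hg : DifferentiableAt ℝ g x) (i : Fin n) :
    pd1 (fun y => f y + g y) i x = pd1 f i x + pd1 g i x :=
  (hf.hasFDerivAt.add hg.hasFDerivAt).pd1_eq i

theorem pd1_sub (hf : DifferentiableAt ℝ f x) (hg : DifferentiableAt ℝ g x) (i : Fin n) :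
    pd1 (fun y => f y - g y) i x = pd1 f i x - pd1 g i x :=
  (hf.hasFDerivAt.sub hg.hasFDerivAt).pd1_eq i

theorem pd1_mul (hf : DifferentiableAt ℝ f x) (hg : DifferentiableAt ℝ g x) (i : Fin n) :
    pd1 (fun y => f y * g y) i x = f x * pd1 g i x + pd1 f i x * g x := by
  refine ((hf.hasFDerivAt.mul hg.hasFDerivAt).pd1_eq i).trans ?_
  simp [pd1, mul_comm]

theorem pd1_sum {ι : Type*} [Fintype ι] {f : ι → EuclideanSpace ℝ (Fin n) → ℝ}
    (hf : ∀ k, DifferentiableAt ℝ (f k) x) (i : Fin n) :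
    pd1 (fun y => ∑ k, f k y) i x = ∑ k, pd1 (f k) i x := by
  rw [(HasFDerivAt.fun_sum (u := Finset.univ) fun k _ => (hf k).hasFDerivAt).pd1_eq i]
  simp [pd1]

theorem pd1_comp {G : ℝ → ℝ} {G' : ℝ} (hG : HasDerivAt G G' (f x))
    (hf : DifferentiableAt ℝ f x) (i : Fin n) :
    pd1 (fun y => G (f y)) i x = G' * pd1 f i x := by
  refine ((hG.comp_hasFDerivAt x hf.hasFDerivAt).pd1_eq i).trans ?_
  simp [pd1]

theorem ContDiffAt.pd1 {m : ℕ} (hf : ContDiffAt ℝ (m + 1) f x) (i : Fin n) :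
    ContDiffAt ℝ m (pd1 f i) x :=
  (hf.fderiv_right le_rfl).clm_apply contDiffAt_const

theorem ContDiffAt.differentiableAt_pd1 (hf : ContDiffAt ℝ 2 f x) (i : Fin n) :
    DifferentiableAt ℝ (_root_.pd1 f i) x :=
  (ContDiffAt.pd1 (m := 1) (by simpa [one_add_one_eq_two] using hf) i).differentiableAt (by simp)

theorem ContDiffAt.eventually_differentiableAt (hf : ContDiffAt ℝ 2 f x) :
    ∀ᶠ y in nhds x, DifferentiableAt ℝ f y :=
  (hf.eventually (by simp)).mono fun _ h => h.differentiableAt (by simp)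

theorem pd2_add (hf : ContDiffAt ℝ 2 f x) (hg : ContDiffAt ℝ 2 g x) (i j : Fin n) :
    pd2 (fun y => f y + g y) i j x = pd2 f i j x + pd2 g i j x := by
  have h : pd1 (fun y => f y + g y) j =ᶠ[nhds x] fun y => pd1 f j y + pd1 g j y := by
    filter_upwards [hf.eventually_differentiableAt, hg.eventually_differentiableAt] with y h1 h2
    exact pd1_add h1 h2 j
  exact (h.pd1_eq i).trans (pd1_add (hf.differentiableAt_pd1 j) (hg.differentiableAt_pd1 j) i)

theorem pd2_sub (hf : ContDiffAt ℝ 2 f x) (hg : ContDiffAt ℝ 2 g x) (i j : Fin n) :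
    pd2 (fun y => f y - g y) i j x = pd2 f i j x - pd2 g i j x := by
  have h : pd1 (fun y => f y - g y) j =ᶠ[nhds x] fun y => pd1 f j y - pd1 g j y := by
    filter_upwards [hf.eventually_differentiableAt, hg.eventually_differentiableAt] with y h1 h2
    exact pd1_sub h1 h2 j
  exact (h.pd1_eq i).trans (pd1_sub (hf.differentiableAt_pd1 j) (hg.differentiableAt_pd1 j) i)

theorem pd2_sum {ι : Type*} [Fintype ι] {f : ι → EuclideanSpace ℝ (Fin n) → ℝ}
    (hf : ∀ k, ContDiffAt ℝ 2 (f k) x) (i j : Fin n) :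
    pd2 (fun y => ∑ k, f k y) i j x = ∑ k, pd2 (f k) i j x := by
  have h : pd1 (fun y => ∑ k, f k y) j =ᶠ[nhds x] fun y => ∑ k, pd1 (f k) j y := by
    filter_upwards [eventually_all.2 fun k => (hf k).eventually_differentiableAt] with y h1
    exact pd1_sum h1 j
  exact (h.pd1_eq i).trans (pd1_sum (fun k => (hf k).differentiableAt_pd1 j) i)

theorem pd2_comp {G G' : ℝ → ℝ} {G'' : ℝ} (hG : ∀ᶠ t in nhds (f x), HasDerivAt G (G' t) t)
    (hG' : HasDerivAt G' G'' (f x)) (hf : ContDiffAt ℝ 2 f x) (i j : Fin n) :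
    pd2 (fun y => G (f y)) i j x
      = G'' * (pd1 f i x * pd1 f j x) + G' (f x) * pd2 f i j x := by
  have h : pd1 (fun y => G (f y)) j =ᶠ[nhds x] fun y => G' (f y) * pd1 f j y := by
    filter_upwards [hf.eventually_differentiableAt, hf.continuousAt.eventually hG] with y h1 h2
    exact pd1_comp h2 h1 j
  have hd := hf.differentiableAt (by simp)
  have h2 : DifferentiableAt ℝ (fun y => G' (f y)) x :=
    (hG'.comp_hasFDerivAt x hd.hasFDerivAt).differentiableAt
  refine (h.pd1_eq i).trans ?_
  rw [pd1_mul h2 (hf.differentiableAt_pd1 j), pd1_comp hG' hd]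
  simp only [pd2, pd1]
  ring

theorem fderiv_pd1_apply (hf : ContDiffAt ℝ 2 f x) (j : Fin n) (ξ : EuclideanSpace ℝ (Fin n)) :
    fderiv ℝ (pd1 f j) x ξ = fderiv ℝ (fderiv ℝ f) x ξ (EuclideanSpace.single j 1) := by
  have h : DifferentiableAt ℝ (fderiv ℝ f) x :=
    (hf.fderiv_right (m := 1) (by simp [one_add_one_eq_two])).differentiableAt (by simp)
  have h2 := h.hasFDerivAt.clm_apply (hasFDerivAt_const (EuclideanSpace.single j (1 : ℝ)) x)
  unfold pd1
  rw [h2.fderiv]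
  simp

theorem pd2_comm (hf : ContDiffAt ℝ 2 f x) (i j : Fin n) : pd2 f i j x = pd2 f j i x := by
  rw [pd2, pd2, fderiv_pd1_apply hf, fderiv_pd1_apply hf]
  exact hf.isSymmSndFDerivAt (by simp) _ _

theorem fderiv_eq_sum_pd1 (f : EuclideanSpace ℝ (Fin n) → ℝ) (x ξ : EuclideanSpace ℝ (Fin n)) :
    fderiv ℝ f x ξ = ∑ i, ξ i * pd1 f i x := by
  have h : ξ = ∑ i, ξ i • EuclideanSpace.single i (1 : ℝ) := by
    ext k
    simp [Finset.sum_apply, Pi.single_apply]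
  conv_lhs => rw [h]
  simp [pd1]

theorem norm_gradient_sq (f : EuclideanSpace ℝ (Fin n) → ℝ) (x : EuclideanSpace ℝ (Fin n)) :
    ‖gradient f x‖ ^ 2 = ∑ i, pd1 f i x ^ 2 := by
  rw [EuclideanSpace.norm_sq_eq]
  refine Finset.sum_congr rfl fun i _ => ?_
  have : pd1 f i x = gradient f x i := by
    have h : inner ℝ (gradient f x) (EuclideanSpace.single i (1 : ℝ)) = pd1 f i x :=
      InnerProductSpace.toDual_symm_apply
    simp only [EuclideanSpace.inner_single_right, one_mul, conj_trivial] at h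
    exact h.symm
  rw [this, Real.norm_eq_abs, sq_abs]

/-- The second order necessary condition at a local minimum. -/
theorem IsLocalMin.sum_pd2_nonneg (hmin : IsLocalMin f x) (hf : ContDiffAt ℝ 2 f x)
    (ξ : Fin n → ℝ) : 0 ≤ ∑ i, ∑ j, ξ i * ξ j * pd2 f i j x := by
  set e : EuclideanSpace ℝ (Fin n) := WithLp.toLp 2 ξ with he
  set c : ℝ → EuclideanSpace ℝ (Fin n) := fun t => x + t • e with hc
  have hc0 : c 0 = x := by simp [hc]
  have hcd : ∀ t, HasDerivAt c e t := fun t => by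
    simpa [hc] using ((hasDerivAt_id t).smul_const e).const_add x
  have hcc : Tendsto c (nhds 0) (nhds x) := by
    simpa [hc0] using (hcd 0).continuousAt.tendsto
  have hderiv : deriv (fun t => f (c t)) =ᶠ[nhds 0] fun t => ∑ j, ξ j * pd1 f j (c t) := by
    filter_upwards [hcc.eventually hf.eventually_differentiableAt] with t ht
    refine (ht.hasFDerivAt.comp_hasDerivAt t (hcd t)).deriv.trans ?_
    rw [fderiv_eq_sum_pd1]
  have hderiv2 : deriv (deriv fun t => f (c t)) 0 = ∑ i, ∑ j, ξ i * ξ j * pd2 f i j x := by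
    rw [hderiv.deriv_eq]
    have : HasDerivAt (fun t => ∑ j, ξ j * pd1 f j (c t))
        (∑ j, ξ j * fderiv ℝ (pd1 f j) x e) 0 := by
      refine HasDerivAt.fun_sum fun j _ => HasDerivAt.const_mul _ ?_
      have h := (hf.differentiableAt_pd1 j).hasFDerivAt
      rw [← hc0] at h
      rw [← hc0]
      exact h.comp_hasDerivAt (0 : ℝ) (hcd 0)
    rw [this.deriv, Finset.sum_comm]
    refine Finset.sum_congr rfl fun j _ => ?_
    rw [fderiv_eq_sum_pd1, Finset.mul_sum]
    refine Finset.sum_congr rfl fun i _ => ?_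
    simp only [pd2, pd1, he]
    ring
  have hmin' : IsLocalMin (fun t => f (c t)) 0 := by
    have := hcc.eventually hmin
    filter_upwards [this] with t ht
    simpa [hc0] using ht
  have hcont : ContinuousAt (fun t => f (c t)) 0 := by
    have h := hf.continuousAt
    rw [← hc0] at h
    exact h.comp (hcd 0).continuousAt
  by_contra! hneg
  rw [← hderiv2] at hneg
  have hmax := isLocalMax_of_deriv_deriv_neg hneg hmin'.deriv_eq_zero hcont
  have hconst : (fun t => f (c t)) =ᶠ[nhds 0] fun _ => f (c 0) := by
    filter_upwards [hmin', hmax] with t h1 h2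
    exact le_antisymm h2 h1
  have h0 : deriv (fun t => f (c t)) =ᶠ[nhds 0] fun _ => 0 := by
    simpa using hconst.deriv
  rw [h0.deriv_eq] at hneg
  simp at hneg

end PartialDerivatives

section LinearAlgebra

variable {ι : Type*} [Fintype ι]

theorem sum_rankOne_coef_mul [DecidableEq ι] (p : ι → ℝ) (v : ℝ) (M : ι → ι → ℝ) :
    ∑ i, ∑ j, ((if i = j then (1 : ℝ) else 0) - p i * p j / v) * M i j
      = ∑ i, M i i - (∑ i, ∑ j, p i * p j * M i j) / v := by
  simp only [sub_mul, Finset.sum_sub_distrib, ite_mul, one_mul, zero_mul, Finset.sum_ite_eq,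
    Finset.mem_univ, if_true, Finset.sum_div]
  congr 1
  refine Finset.sum_congr rfl fun i _ => Finset.sum_congr rfl fun j _ => ?_
  ring

theorem quadratic_form_le_trace {M : ι → ι → ℝ}
    (hM : ∀ ξ : ι → ℝ, 0 ≤ ∑ i, ∑ j, ξ i * ξ j * M i j) (p : ι → ℝ) :
    ∑ i, ∑ j, p i * p j * M i j ≤ (∑ i, p i ^ 2) * ∑ i, M i i := by
  classical
  have key : ∀ i j, 0 ≤ p i ^ 2 * M j j + p j ^ 2 * M i i - p i * p j * M i j
      - p i * p j * M j i := by
    intro i j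
    have h := hM fun k => p i * (if k = j then 1 else 0) - p j * (if k = i then 1 else 0)
    simp only [mul_sub, sub_mul, Finset.sum_sub_distrib, mul_ite, ite_mul, mul_one, mul_zero,
      zero_mul, Finset.sum_ite_eq', Finset.mem_univ, if_true] at h
    nlinarith [h]
  have h := Finset.sum_nonneg fun i (_ : i ∈ Finset.univ) =>
    Finset.sum_nonneg fun j (_ : j ∈ Finset.univ) => key i j
  simp only [Finset.sum_add_distrib, Finset.sum_sub_distrib] at h
  have e1 : ∑ i, ∑ j, p i ^ 2 * M j j = (∑ i, p i ^ 2) * ∑ i, M i i := by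
    rw [Finset.sum_mul_sum]
  have e2 : ∑ i, ∑ j, p j ^ 2 * M i i = (∑ i, p i ^ 2) * ∑ i, M i i := by
    rw [Finset.sum_comm, e1]
  have e3 : ∑ i, ∑ j, p i * p j * M j i = ∑ i, ∑ j, p i * p j * M i j := by
    rw [Finset.sum_comm]
    refine Finset.sum_congr rfl fun i _ => Finset.sum_congr rfl fun j _ => ?_
    ring
  rw [e1, e2, e3] at h
  linarith

theorem trace_sub_quadratic_form_div_nonneg {M : ι → ι → ℝ}
    (hM : ∀ ξ : ι → ℝ, 0 ≤ ∑ i, ∑ j, ξ i * ξ j * M i j) {p : ι → ℝ} {v : ℝ}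
    (hv : v = 1 + ∑ i, p i ^ 2) :
    0 ≤ ∑ i, M i i - (∑ i, ∑ j, p i * p j * M i j) / v := by
  classical
  have hp : 0 ≤ ∑ i, p i ^ 2 := Finset.sum_nonneg fun i _ => sq_nonneg _
  have htr : 0 ≤ ∑ i, M i i := by
    refine Finset.sum_nonneg fun i _ => ?_
    have h := hM fun k => if k = i then 1 else 0
    simpa using h
  have h := quadratic_form_le_trace hM p
  rw [sub_nonneg, div_le_iff₀ (by linarith)]
  nlinarith

/-- The squared norm of the second fundamental form is nonnegative: with `a = I - ppᵀ/v`, this is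
`tr (a H a H) ≥ 0`. -/
theorem trace_mul_mul_mul_nonneg {p : ι → ℝ} {v : ℝ} (hv : v = 1 + ∑ i, p i ^ 2)
    {H : ι → ι → ℝ} (hH : ∀ i j, H i j = H j i) {h : ι → ℝ} (hh : ∀ i, h i = ∑ j, H i j * p j) :
    0 ≤ ∑ k, ∑ i, H i k ^ 2 - (∑ i, h i ^ 2) / v
      - (∑ i, h i ^ 2 - (∑ i, p i * h i) ^ 2 / v) / v := by
  have hp : 0 ≤ ∑ i, p i ^ 2 := Finset.sum_nonneg fun i _ => sq_nonneg _
  have hv0 : 0 < v := by linarith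
  set M : ι → ι → ℝ := fun k l => ∑ i, H i k * H i l - h k * h l / v with hMdef
  have hform : ∀ ξ : ι → ℝ, ∑ k, ∑ l, ξ k * ξ l * M k l
      = ∑ i, (∑ k, H i k * ξ k) ^ 2 - (∑ k, h k * ξ k) ^ 2 / v := by
    intro ξ
    simp only [hMdef, mul_sub, Finset.sum_sub_distrib]
    congr 1
    · simp only [sq, Finset.sum_mul_sum]
      conv_rhs => rw [Finset.sum_comm]
      refine Finset.sum_congr rfl fun k _ => ?_
      conv_rhs => rw [Finset.sum_comm]
      refine Finset.sum_congr rfl fun l _ => ?_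
      rw [Finset.mul_sum]
      exact Finset.sum_congr rfl fun i _ => by ring
    · simp only [sq, Finset.sum_mul_sum, Finset.sum_div]
      refine Finset.sum_congr rfl fun i _ => Finset.sum_congr rfl fun j _ => ?_
      ring
  have hdual : ∀ ξ : ι → ℝ, ∑ k, h k * ξ k = ∑ i, p i * ∑ k, H i k * ξ k := by
    intro ξ
    simp only [hh, Finset.sum_mul, Finset.mul_sum]
    rw [Finset.sum_comm]
    refine Finset.sum_congr rfl fun i _ => Finset.sum_congr rfl fun j _ => ?_
    rw [hH j i]
    ring
  have hM : ∀ ξ : ι → ℝ, 0 ≤ ∑ k, ∑ l, ξ k * ξ l * M k l := by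
    intro ξ
    rw [hform, hdual, sub_nonneg, div_le_iff₀ hv0]
    have hcs := Finset.sum_mul_sq_le_sq_mul_sq Finset.univ p fun i => ∑ k, H i k * ξ k
    have : 0 ≤ ∑ i, (∑ k, H i k * ξ k) ^ 2 := Finset.sum_nonneg fun i _ => sq_nonneg _
    nlinarith
  have hres := trace_sub_quadratic_form_div_nonneg hM hv
  rw [hform p] at hres
  simp only [← hh] at hres
  convert hres using 2
  · simp only [hMdef, Finset.sum_sub_distrib, ← sq, Finset.sum_div]
  · simp only [mul_comm]

end LinearAlgebra

section MinimalSurface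

variable {n : ℕ} {u : EuclideanSpace ℝ (Fin n) → ℝ} {x : EuclideanSpace ℝ (Fin n)}

/-- The squared area element `1 + |∇u|²` of the graph of `u`. -/
noncomputable def areaSq (u : EuclideanSpace ℝ (Fin n) → ℝ) (x : EuclideanSpace ℝ (Fin n)) : ℝ :=
  1 + ∑ k, pd1 u k x ^ 2

/-- The mean curvature operator of `u`, linearised in the highest order terms, applied to `f`. -/
noncomputable def graphLaplacian (u f : EuclideanSpace ℝ (Fin n) → ℝ)
    (x : EuclideanSpace ℝ (Fin n)) : ℝ :=
  ∑ i, ∑ j, aCoef u i j x * pd2 f i j x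

theorem one_le_areaSq (u : EuclideanSpace ℝ (Fin n) → ℝ) (x : EuclideanSpace ℝ (Fin n)) :
    1 ≤ areaSq u x :=
  le_add_of_nonneg_right (Finset.sum_nonneg fun _ _ => sq_nonneg _)

theorem areaSq_eq (u : EuclideanSpace ℝ (Fin n) → ℝ) (x : EuclideanSpace ℝ (Fin n)) :
    areaSq u x = 1 + ‖gradient u x‖ ^ 2 := by
  rw [norm_gradient_sq, areaSq]

theorem sum_aCoef_mul (u : EuclideanSpace ℝ (Fin n) → ℝ) (x : EuclideanSpace ℝ (Fin n))
    (M : Fin n → Fin n → ℝ) :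
    ∑ i, ∑ j, aCoef u i j x * M i j
      = ∑ i, M i i - (∑ i, ∑ j, pd1 u i x * pd1 u j x * M i j) / areaSq u x := by
  simp only [aCoef, ← areaSq_eq]
  exact sum_rankOne_coef_mul _ _ _

theorem sum_aCoef_mul_mul (u : EuclideanSpace ℝ (Fin n) → ℝ) (x : EuclideanSpace ℝ (Fin n))
    (q : Fin n → ℝ) :
    ∑ i, ∑ j, aCoef u i j x * (q i * q j)
      = ∑ i, q i ^ 2 - (∑ i, pd1 u i x * q i) ^ 2 / areaSq u x := by
  rw [sum_aCoef_mul]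
  congr 2
  · simp only [sq]
  · rw [sq, Finset.sum_mul_sum]
    refine Finset.sum_congr rfl fun i _ => Finset.sum_congr rfl fun j _ => ?_
    ring

theorem pd1_pd2_eq (hu : ContDiffAt ℝ 3 u x) (i j k : Fin n) :
    pd1 (pd2 u i j) k x = pd2 (pd1 u k) i j x := by
  have hu1 : ∀ j, ContDiffAt ℝ 2 (pd1 u j) x := fun j => ContDiffAt.pd1 (m := 2) hu j
  have hsymm : pd2 u k j =ᶠ[nhds x] pd2 u j k :=
    (hu.eventually (by simp)).mono fun y hy => pd2_comm (hy.of_le (by norm_num)) k j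
  calc pd1 (pd2 u i j) k x = pd2 (pd1 u j) k i x := rfl
    _ = pd2 (pd1 u j) i k x := pd2_comm (hu1 j) k i
    _ = pd1 (pd2 u k j) i x := rfl
    _ = pd1 (pd2 u j k) i x := hsymm.pd1_eq i
    _ = pd2 (pd1 u k) i j x := rfl

theorem pd1_areaSq (hu : ContDiffAt ℝ 3 u x) (i : Fin n) :
    pd1 (areaSq u) i x = 2 * ∑ k, pd2 u i k x * pd1 u k x := by
  have hu1 : ∀ j, DifferentiableAt ℝ (pd1 u j) x := (hu.of_le (by norm_num)).differentiableAt_pd1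
  unfold areaSq
  have hsq : ∀ k, DifferentiableAt ℝ (fun y => pd1 u k y ^ 2) x := fun k => (hu1 k).fun_pow 2
  rw [pd1_add (differentiableAt_const 1) (DifferentiableAt.fun_sum fun k _ => hsq k),
    pd1_sum hsq, Finset.mul_sum]
  have h0 : pd1 (fun _ : EuclideanSpace ℝ (Fin n) => (1 : ℝ)) i x = 0 := by simp [pd1]
  rw [h0, zero_add]
  refine Finset.sum_congr rfl fun k _ => ?_
  rw [pd1_comp (G := fun t => t ^ 2) (hasDerivAt_pow 2 _) (hu1 k)]
  simp only [pd2, pd1]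
  ring

theorem ContDiffAt.areaSq (hu : ContDiffAt ℝ 3 u x) : ContDiffAt ℝ 2 (areaSq u) x :=
  contDiffAt_const.add
    (ContDiffAt.sum fun k _ => (ContDiffAt.pd1 (m := 2) hu k).pow 2)

theorem pd2_areaSq (hu : ContDiffAt ℝ 3 u x) (i j : Fin n) :
    pd2 (areaSq u) i j x
      = ∑ k, (2 * (pd2 u i k x * pd2 u j k x) + 2 * (pd1 u k x * pd2 (pd1 u k) i j x)) := by
  have hu1 : ∀ j, ContDiffAt ℝ 2 (pd1 u j) x := fun j => ContDiffAt.pd1 (m := 2) hu j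
  unfold areaSq
  rw [pd2_add contDiffAt_const (ContDiffAt.sum fun k _ => (hu1 k).pow 2),
    pd2_sum fun k => (hu1 k).pow 2]
  have h0 : pd2 (fun _ : EuclideanSpace ℝ (Fin n) => (1 : ℝ)) i j x = 0 := by
    have : pd1 (fun _ : EuclideanSpace ℝ (Fin n) => (1 : ℝ)) j = fun _ => 0 := by
      ext y
      simp [pd1]
    simp [pd2, this]
  rw [h0, zero_add]
  refine Finset.sum_congr rfl fun k _ => ?_
  rw [pd2_comp (G := fun t => t ^ 2) (G' := fun t => 2 * t) (G'' := 2)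
    (Eventually.of_forall fun t => by simpa using hasDerivAt_pow 2 t)
    (by simpa using (hasDerivAt_id (pd1 u k x)).const_mul 2) (hu1 k)]
  simp only [pd2, pd1]
  ring

theorem areaSq_mul_sum_pd2_eq (h : mcOp u x = 0) :
    areaSq u x * ∑ i, pd2 u i i x - ∑ i, ∑ j, pd1 u i x * pd1 u j x * pd2 u i j x = 0 := by
  rw [mcOp, sum_aCoef_mul] at h
  have := one_le_areaSq u x
  field_simp at h
  linarith

theorem differentiated_equation (hu : ContDiffAt ℝ 3 u x) (h : ∀ᶠ y in nhds x, mcOp u y = 0)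
    (k : Fin n) :
    areaSq u x * ∑ i, pd2 (pd1 u k) i i x
        - ∑ i, ∑ j, pd1 u i x * pd1 u j x * pd2 (pd1 u k) i j x
      = 2 * ∑ i, pd2 u k i x * ∑ j, pd2 u i j x * pd1 u j x
        - 2 * (∑ i, pd2 u k i x * pd1 u i x) * ∑ i, pd2 u i i x := by
  have hu2 : ContDiffAt ℝ 2 u x := hu.of_le (by norm_num)
  have d1 : ∀ i, DifferentiableAt ℝ (pd1 u i) x := hu2.differentiableAt_pd1
  have d2 : ∀ i j, DifferentiableAt ℝ (pd2 u i j) x := fun i j =>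
    (ContDiffAt.pd1 (m := 2) hu j).differentiableAt_pd1 i
  have hp : ∀ i, pd1 (pd1 u i) k x = pd2 u k i x := fun _ => rfl
  have dW : DifferentiableAt ℝ (areaSq u) x := hu.areaSq.differentiableAt (by simp)
  have dt : DifferentiableAt ℝ (fun y => ∑ i, pd2 u i i y) x :=
    DifferentiableAt.fun_sum fun i _ => d2 i i
  have dp : ∀ i j, DifferentiableAt ℝ (fun y => pd1 u i y * pd1 u j y) x := fun i j =>
    (d1 i).mul (d1 j)
  have dq : ∀ i j, DifferentiableAt ℝ (fun y => pd1 u i y * pd1 u j y * pd2 u i j y) x :=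
    fun i j => (dp i j).mul (d2 i j)
  have ds : ∀ i, DifferentiableAt ℝ (fun y => ∑ j, pd1 u i y * pd1 u j y * pd2 u i j y) x :=
    fun i => DifferentiableAt.fun_sum fun j _ => dq i j
  have hz : pd1 (fun y => areaSq u y * ∑ i, pd2 u i i y
      - ∑ i, ∑ j, pd1 u i y * pd1 u j y * pd2 u i j y) k x = 0 := by
    have : (fun y => areaSq u y * ∑ i, pd2 u i i y
      - ∑ i, ∑ j, pd1 u i y * pd1 u j y * pd2 u i j y) =ᶠ[nhds x] fun _ => 0 :=
      h.mono fun y hy => areaSq_mul_sum_pd2_eq hy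
    rw [this.pd1_eq k]
    simp [pd1]
  rw [pd1_sub (dW.fun_mul dt) (DifferentiableAt.fun_sum fun i _ => ds i), pd1_mul dW dt,
    pd1_sum fun i => d2 i i, pd1_sum ds, pd1_areaSq hu] at hz
  have hterm : ∀ i, pd1 (fun y => ∑ j, pd1 u i y * pd1 u j y * pd2 u i j y) k x
      = ∑ j, pd1 u i x * pd1 u j x * pd2 (pd1 u k) i j x
        + ∑ j, pd1 u i x * pd2 u k j x * pd2 u i j x
        + ∑ j, pd2 u k i x * (pd2 u i j x * pd1 u j x) := by
    intro i
    rw [pd1_sum (dq i), ← Finset.sum_add_distrib, ← Finset.sum_add_distrib]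
    refine Finset.sum_congr rfl fun j _ => ?_
    rw [pd1_mul (dp i j) (d2 i j), pd1_mul (d1 i) (d1 j), pd1_pd2_eq hu, hp, hp]
    ring
  simp only [hterm, Finset.sum_add_distrib, pd1_pd2_eq hu] at hz
  have e : ∑ i, ∑ j, pd1 u i x * pd2 u k j x * pd2 u i j x
      = ∑ i, ∑ j, pd2 u k i x * (pd2 u i j x * pd1 u j x) := by
    rw [Finset.sum_comm]
    refine Finset.sum_congr rfl fun i _ => Finset.sum_congr rfl fun j _ => ?_
    rw [pd2_comm hu2 i j]
    ring
  rw [e] at hz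
  simp only [Finset.mul_sum (Finset.univ) _ (pd2 u k _ x)]
  linarith

theorem graphLaplacian_areaSq (hu : ContDiffAt ℝ 3 u x) (h : ∀ᶠ y in nhds x, mcOp u y = 0)
    {g : Fin n → ℝ} (hg : ∀ i, g i = ∑ k, pd2 u i k x * pd1 u k x) :
    graphLaplacian u (areaSq u) x
      = 2 * (∑ k, ∑ i, pd2 u i k x ^ 2 - (∑ i, g i ^ 2) / areaSq u x)
        + 4 * (∑ i, g i ^ 2 - (∑ i, pd1 u i x * g i) ^ 2 / areaSq u x) / areaSq u x := by
  have hu2 : ContDiffAt ℝ 2 u x := hu.of_le (by norm_num)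
  have hv := one_le_areaSq u x
  have hv0 : areaSq u x ≠ 0 := by linarith
  have hsum : graphLaplacian u (areaSq u) x
      = ∑ k, (2 * ∑ i, ∑ j, aCoef u i j x * (pd2 u i k x * pd2 u j k x)
        + 2 * (pd1 u k x * ∑ i, ∑ j, aCoef u i j x * pd2 (pd1 u k) i j x)) := by
    simp only [graphLaplacian, pd2_areaSq hu, Finset.mul_sum, ← Finset.sum_add_distrib]
    conv_rhs => rw [Finset.sum_comm]
    refine Finset.sum_congr rfl fun i _ => ?_
    conv_rhs => rw [Finset.sum_comm]
    exact Finset.sum_congr rfl fun j _ => Finset.sum_congr rfl fun k _ => by ring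
  have hT : ∀ k, ∑ i, ∑ j, aCoef u i j x * pd2 (pd1 u k) i j x
      = (2 * ∑ i, pd2 u i k x * g i - 2 * g k * ∑ i, pd2 u i i x) / areaSq u x := by
    intro k
    rw [sum_aCoef_mul, eq_div_iff hv0, sub_mul, div_mul_cancel₀ _ hv0]
    have := differentiated_equation hu h k
    simp only [← hg] at this
    simp only [pd2_comm hu2 _ k]
    linarith
  have hQ : ∀ k, ∑ i, pd1 u i x * pd2 u i k x = g k := fun k => by
    rw [hg]
    exact Finset.sum_congr rfl fun i _ => by rw [pd2_comm hu2 i k, mul_comm]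
  simp only [hsum, sum_aCoef_mul_mul, hT, hQ]
  have htr : ∑ i, pd2 u i i x = (∑ i, pd1 u i x * g i) / areaSq u x := by
    rw [eq_div_iff hv0]
    have := areaSq_mul_sum_pd2_eq h.self_of_nhds
    have e : ∑ i, ∑ j, pd1 u i x * pd1 u j x * pd2 u i j x = ∑ i, pd1 u i x * g i := by
      refine Finset.sum_congr rfl fun i _ => ?_
      rw [hg, Finset.mul_sum]
      exact Finset.sum_congr rfl fun j _ => by ring
    linarith
  have hgg : ∑ k, pd1 u k x * ∑ i, pd2 u i k x * g i = ∑ i, g i ^ 2 := by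
    simp only [Finset.mul_sum]
    rw [Finset.sum_comm]
    refine Finset.sum_congr rfl fun i _ => ?_
    rw [sq]
    nth_rewrite 3 [hg i]
    rw [Finset.mul_sum]
    exact Finset.sum_congr rfl fun j _ => by ring
  have hlast : ∑ k, pd1 u k x * ((2 * ∑ i, pd2 u i k x * g i - 2 * g k * ∑ i, pd2 u i i x)
      / areaSq u x) = (2 * ∑ i, g i ^ 2
        - 2 * (∑ i, pd1 u i x * g i) * ∑ i, pd2 u i i x) / areaSq u x := by
    rw [← hgg, Finset.mul_sum, Finset.mul_sum _ (fun i => pd1 u i x * g i),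
      Finset.sum_mul _ _ (∑ i, pd2 u i i x), ← Finset.sum_sub_distrib, Finset.sum_div]
    exact Finset.sum_congr rfl fun j _ => by ring
  rw [Finset.sum_add_distrib, ← Finset.mul_sum, ← Finset.mul_sum, hlast, htr,
    Finset.sum_sub_distrib, ← Finset.sum_div]
  ring

theorem graphLaplacian_comp {f : EuclideanSpace ℝ (Fin n) → ℝ} {G G' : ℝ → ℝ} {G'' : ℝ}
    (hG : ∀ᶠ t in nhds (f x), HasDerivAt G (G' t) t) (hG' : HasDerivAt G' G'' (f x))
    (hf : ContDiffAt ℝ 2 f x) :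
    graphLaplacian u (fun y => G (f y)) x
      = G'' * (∑ i, pd1 f i x ^ 2 - (∑ i, pd1 u i x * pd1 f i x) ^ 2 / areaSq u x)
        + G' (f x) * graphLaplacian u f x := by
  rw [← sum_aCoef_mul_mul, graphLaplacian, graphLaplacian]
  simp only [pd2_comp hG hG' hf, mul_add, Finset.sum_add_distrib, Finset.mul_sum]
  congr 1 <;> refine Finset.sum_congr rfl fun i _ => Finset.sum_congr rfl fun j _ => by ring

/-- The vertical component of the unit normal of a minimal graph is superharmonic. -/
theorem graphLaplacian_areaSq_rpow_nonpos (hu : ContDiffAt ℝ 3 u x)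
    (h : ∀ᶠ y in nhds x, mcOp u y = 0) :
    graphLaplacian u (fun y => areaSq u y ^ (-1 / 2 : ℝ)) x ≤ 0 := by
  have hv := one_le_areaSq u x
  have hv0 : 0 < areaSq u x := by linarith
  have hG : ∀ᶠ t in nhds (areaSq u x),
      HasDerivAt (fun t : ℝ => t ^ (-1 / 2 : ℝ)) (-1 / 2 * t ^ (-3 / 2 : ℝ)) t := by
    filter_upwards [lt_mem_nhds hv0] with t ht
    exact (Real.hasDerivAt_rpow_const (p := (-1 / 2 : ℝ)) (Or.inl ht.ne')).congr_deriv
      (by norm_num)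
  have hG' : HasDerivAt (fun t : ℝ => -1 / 2 * t ^ (-3 / 2 : ℝ))
      (3 / 4 * (areaSq u x ^ (-3 / 2 : ℝ) / areaSq u x)) (areaSq u x) := by
    refine ((Real.hasDerivAt_rpow_const (p := (-3 / 2 : ℝ)) (Or.inl hv0.ne')).const_mul
      (-1 / 2 : ℝ)).congr_deriv ?_
    rw [Real.rpow_sub_one hv0.ne']
    ring
  rw [graphLaplacian_comp hG hG' hu.areaSq, graphLaplacian_areaSq hu h fun _ => rfl]
  simp only [pd1_areaSq hu]
  have hJ := trace_mul_mul_mul_nonneg (v := areaSq u x) rfl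
    (pd2_comm (hu.of_le (by norm_num) : ContDiffAt ℝ 2 u x)) (fun _ => rfl)
  set g : Fin n → ℝ := fun i => ∑ k, pd2 u i k x * pd1 u k x
  have e1 : ∑ i, (2 * g i) ^ 2 = 4 * ∑ i, g i ^ 2 := by
    rw [Finset.mul_sum]
    exact Finset.sum_congr rfl fun _ _ => by ring
  have e2 : ∑ i, pd1 u i x * (2 * g i) = 2 * ∑ i, pd1 u i x * g i := by
    rw [Finset.mul_sum]
    exact Finset.sum_congr rfl fun _ _ => by ring
  change _ * (∑ i, (2 * g i) ^ 2 - (∑ i, pd1 u i x * (2 * g i)) ^ 2 / _)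
    + _ * (2 * (_ - (∑ i, g i ^ 2) / _) + 4 * (∑ i, g i ^ 2 - (∑ i, pd1 u i x * g i) ^ 2 / _) / _) ≤ 0
  change 0 ≤ _ - (∑ i, g i ^ 2) / _ - (∑ i, g i ^ 2 - (∑ i, pd1 u i x * g i) ^ 2 / _) / _ at hJ
  rw [e1, e2]
  have hpos : 0 < areaSq u x ^ (-3 / 2 : ℝ) := Real.rpow_pos_of_pos hv0 _
  have := mul_nonneg hpos.le hJ
  refine le_of_eq_of_le ?_ (neg_nonpos.2 this)
  ring

theorem graphLaplacian_nonneg_of_isLocalMin {f : EuclideanSpace ℝ (Fin n) → ℝ}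
    (hf : ContDiffAt ℝ 2 f x) (hmin : IsLocalMin f x) : 0 ≤ graphLaplacian u f x := by
  rw [graphLaplacian, sum_aCoef_mul]
  exact trace_sub_quadratic_form_div_nonneg (hmin.sum_pd2_nonneg hf) rfl

theorem graphLaplacian_sub {f g : EuclideanSpace ℝ (Fin n) → ℝ} (hf : ContDiffAt ℝ 2 f x)
    (hg : ContDiffAt ℝ 2 g x) :
    graphLaplacian u (fun y => f y - g y) x = graphLaplacian u f x - graphLaplacian u g x := by
  simp only [graphLaplacian, pd2_sub hf hg, mul_sub, Finset.sum_sub_distrib]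

theorem pd1_const_mul_norm_sq (b : ℝ) (i : Fin n) (x : EuclideanSpace ℝ (Fin n)) :
    pd1 (fun y => b * ‖y‖ ^ 2) i x = 2 * b * x i := by
  rw [((hasStrictFDerivAt_norm_sq x).hasFDerivAt.const_mul b).pd1_eq i]
  simp [EuclideanSpace.inner_single_right]
  ring

theorem pd2_const_mul_norm_sq (b : ℝ) (i j : Fin n) (x : EuclideanSpace ℝ (Fin n)) :
    pd2 (fun y => b * ‖y‖ ^ 2) i j x = if i = j then 2 * b else 0 := by
  have h : pd1 (fun y : EuclideanSpace ℝ (Fin n) => b * ‖y‖ ^ 2) j = fun y => 2 * b * y j :=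
    funext fun y => pd1_const_mul_norm_sq b j y
  have h2 : HasFDerivAt (fun y : EuclideanSpace ℝ (Fin n) => 2 * b * y j)
      ((2 * b) • (EuclideanSpace.proj j : EuclideanSpace ℝ (Fin n) →L[ℝ] ℝ)) x :=
    (EuclideanSpace.proj (𝕜 := ℝ) j).hasFDerivAt.const_mul (2 * b)
  rw [pd2, h, h2.fderiv]
  simp [eq_comm]

theorem contDiff_const_mul_norm_sq (b : ℝ) :
    ContDiff ℝ 2 fun y : EuclideanSpace ℝ (Fin n) => b * ‖y‖ ^ 2 :=
  contDiff_const.mul (contDiff_norm_sq ℝ)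

theorem sum_pd1_sq (u : EuclideanSpace ℝ (Fin n) → ℝ) (x : EuclideanSpace ℝ (Fin n)) :
    ∑ i, pd1 u i x ^ 2 = areaSq u x - 1 := by
  rw [areaSq]
  ring

theorem graphLaplacian_const_mul_norm_sq (b : ℝ) (u : EuclideanSpace ℝ (Fin n) → ℝ)
    (x : EuclideanSpace ℝ (Fin n)) :
    graphLaplacian u (fun y => b * ‖y‖ ^ 2) x = 2 * b * (n - 1 + (areaSq u x)⁻¹) := by
  have hv := one_le_areaSq u x
  have hsum : ∑ i, pd1 u i x * pd1 u i x * (2 * b) = 2 * b * (areaSq u x - 1) := by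
    rw [← sum_pd1_sq, Finset.mul_sum]
    exact Finset.sum_congr rfl fun i _ => by ring
  simp only [graphLaplacian, pd2_const_mul_norm_sq, sum_aCoef_mul]
  simp only [if_true, mul_ite, mul_zero, Finset.sum_ite_eq, Finset.mem_univ, hsum]
  simp only [Finset.sum_const, Finset.card_univ, Fintype.card_fin, nsmul_eq_mul]
  field_simp
  ring

theorem graphLaplacian_comp_sub_norm_sq {F F' : ℝ → ℝ} {F'' : ℝ} (b : ℝ)
    (hF : ∀ᶠ t in nhds (u x), HasDerivAt F (F' t) t) (hF' : HasDerivAt F' F'' (u x))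
    (hFu : ContDiffAt ℝ 2 (fun y => F (u y)) x) (hu : ContDiffAt ℝ 2 u x) (h : mcOp u x = 0) :
    graphLaplacian u (fun y => F (u y) - b * ‖y‖ ^ 2) x
      = F'' * (1 - (areaSq u x)⁻¹) - 2 * b * (n - 1 + (areaSq u x)⁻¹) := by
  have hv := one_le_areaSq u x
  have h' : graphLaplacian u u x = 0 := h
  have hsum : ∑ i, pd1 u i x * pd1 u i x = areaSq u x - 1 := by
    simp only [← sq, sum_pd1_sq]
  rw [graphLaplacian_sub hFu (contDiff_const_mul_norm_sq b).contDiffAt,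
    graphLaplacian_const_mul_norm_sq, graphLaplacian_comp hF hF' hu, h', hsum, sum_pd1_sq]
  field_simp
  ring

/-- Lower bound for the squared tangential gradient of `c u - b |x|²` on the graph of `u`. -/
theorem le_tangential_gradient_sq (u : EuclideanSpace ℝ (Fin n) → ℝ)
    (x : EuclideanSpace ℝ (Fin n)) {b c : ℝ} (hb : 0 ≤ b) (hc : 0 ≤ c) {q : Fin n → ℝ}
    (hq : ∀ i, q i = c * pd1 u i x - 2 * b * x i) :
    (c ^ 2 * ‖gradient u x‖ ^ 2 - 4 * b * c * ‖gradient u x‖ * ‖x‖) / areaSq u x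
      ≤ ∑ i, q i ^ 2 - (∑ i, pd1 u i x * q i) ^ 2 / areaSq u x := by
  have hv := one_le_areaSq u x
  have hv0 : 0 < areaSq u x := by linarith
  set P := ‖gradient u x‖ with hP
  set m := ∑ i, pd1 u i x * x i with hm
  have hx : ∑ i, x i ^ 2 = ‖x‖ ^ 2 := (EuclideanSpace.real_norm_sq_eq x).symm
  have hPs : ∑ i, pd1 u i x ^ 2 = P ^ 2 := (norm_gradient_sq u x).symm
  have hvP : areaSq u x = 1 + P ^ 2 := areaSq_eq u x
  have hcs : m ^ 2 ≤ P ^ 2 * ‖x‖ ^ 2 := by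
    rw [← hx, ← hPs]
    exact Finset.sum_mul_sq_le_sq_mul_sq _ _ _
  have hm_le : m ≤ P * ‖x‖ := by
    refine le_of_sq_le_sq ?_ (by positivity)
    rwa [mul_pow]
  have e1 : ∑ i, q i ^ 2 = c ^ 2 * P ^ 2 - 4 * b * c * m + 4 * b ^ 2 * ‖x‖ ^ 2 := by
    rw [← hx, ← hPs, hm, Finset.mul_sum, Finset.mul_sum, Finset.mul_sum,
      ← Finset.sum_sub_distrib, ← Finset.sum_add_distrib]
    exact Finset.sum_congr rfl fun i _ => by rw [hq]; ring
  have e2 : ∑ i, pd1 u i x * q i = c * P ^ 2 - 2 * b * m := by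
    rw [← hPs, hm, Finset.mul_sum, Finset.mul_sum, ← Finset.sum_sub_distrib]
    exact Finset.sum_congr rfl fun i _ => by rw [hq]; ring
  rw [e1, e2, div_le_iff₀ hv0, sub_mul, div_mul_cancel₀ _ hv0.ne', hvP]
  have h1 : 0 ≤ b * c * (P * ‖x‖ - m) := mul_nonneg (mul_nonneg hb hc) (by linarith)
  have h2 : 0 ≤ b ^ 2 * ((1 + P ^ 2) * ‖x‖ ^ 2 - m ^ 2) :=
    mul_nonneg (sq_nonneg b) (by nlinarith [sq_nonneg ‖x‖])
  nlinarith

variable {R r : ℝ}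

theorem continuousOn_fderiv_ball (hu : ContDiffOn ℝ 1 u (ball 0 R)) :
    ContinuousOn (fderiv ℝ u) (ball 0 R) :=
  hu.continuousOn_fderiv_of_isOpen isOpen_ball le_rfl

theorem continuousOn_areaSq (hu : ContDiffOn ℝ 1 u (ball 0 R)) :
    ContinuousOn (areaSq u) (ball 0 R) :=
  continuousOn_const.add (continuousOn_finsetSum _ fun _ _ =>
    ((continuousOn_fderiv_ball hu).clm_apply continuousOn_const).pow 2)

theorem ball_inter_gradient_ne_zero_mem_nhds (hu : ContDiffOn ℝ 1 u (ball 0 R))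
    (hx : x ∈ ball 0 R) (hg : gradient u x ≠ 0) :
    ball 0 R ∩ {x | gradient u x ≠ 0} ∈ nhds x := by
  have hR := isOpen_ball.mem_nhds hx
  refine Filter.inter_mem hR ?_
  have hc : ContinuousAt (gradient u) x :=
    (InnerProductSpace.toDual ℝ (EuclideanSpace ℝ (Fin n))).symm.continuous.continuousAt.comp
      ((continuousOn_fderiv_ball hu).continuousAt hR)
  exact hc.eventually_ne hg

/-- Comparison of the vertical component of the normal with a lower barrier. -/
theorem barrier_le_areaSq_rpow (hr : 0 < r) (hrR : r < R) (hu : ContDiffOn ℝ 1 u (ball 0 R))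
    (hu3 : ContDiffOn ℝ 3 u (ball 0 R ∩ {x | gradient u x ≠ 0}))
    (heq : ∀ x ∈ ball (0 : EuclideanSpace ℝ (Fin n)) R, gradient u x ≠ 0 → mcOp u x = 0)
    {η : EuclideanSpace ℝ (Fin n) → ℝ} (hηc : ContinuousOn η (closedBall 0 r))
    (hη : ∀ x, ContDiffAt ℝ 3 u x → ContDiffAt ℝ 2 η x) (hbd : ∀ x, ‖x‖ = r → η x ≤ 0)
    (hle : ∀ x ∈ ball (0 : EuclideanSpace ℝ (Fin n)) r, η x ≤ 1)
    (hlap : ∀ x ∈ ball (0 : EuclideanSpace ℝ (Fin n)) r, ContDiffAt ℝ 3 u x → mcOp u x = 0 →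
      areaSq u x ^ (-1 / 2 : ℝ) < η x → 0 < graphLaplacian u η x) :
    η 0 ≤ areaSq u 0 ^ (-1 / 2 : ℝ) := by
  have hpos : ∀ x, 0 < areaSq u x := fun x => by linarith [one_le_areaSq u x]
  have hsub : closedBall (0 : EuclideanSpace ℝ (Fin n)) r ⊆ ball 0 R := closedBall_subset_ball hrR
  have hcont : ContinuousOn (fun x => areaSq u x ^ (-1 / 2 : ℝ) - η x) (closedBall 0 r) :=
    (((continuousOn_areaSq hu).mono hsub).rpow_const fun x _ => Or.inl (hpos x).ne').sub hηc
  obtain ⟨x₀, hx₀, hmin⟩ := (isCompact_closedBall (0 : EuclideanSpace ℝ (Fin n)) r).exists_isMinOn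
    (nonempty_closedBall.2 hr.le) hcont
  have h0 := hmin (mem_closedBall_self hr.le)
  by_contra! hneg
  have hlt : areaSq u x₀ ^ (-1 / 2 : ℝ) < η x₀ := by
    simp only [Set.mem_ofPred_eq] at h0
    linarith
  have hs := Real.rpow_pos_of_pos (hpos x₀) (-1 / 2 : ℝ)
  have hball : x₀ ∈ ball 0 r := by
    rw [mem_ball_zero_iff]
    refine lt_of_le_of_ne (mem_closedBall_zero_iff.1 hx₀) fun h => ?_
    linarith [hbd x₀ h]
  have hgrad : gradient u x₀ ≠ 0 := by
    intro h
    have h1 : areaSq u x₀ = 1 := by simp [areaSq_eq, h]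
    rw [h1, Real.one_rpow] at hlt
    linarith [hle x₀ hball]
  have hnhds := ball_inter_gradient_ne_zero_mem_nhds hu (hsub hx₀) hgrad
  have hu3x := hu3.contDiffAt hnhds
  have hev : ∀ᶠ y in nhds x₀, mcOp u y = 0 :=
    Filter.mem_of_superset hnhds fun y hy => heq y hy.1 hy.2
  have hloc : IsLocalMin (fun x => areaSq u x ^ (-1 / 2 : ℝ) - η x) x₀ :=
    hmin.isLocalMin (Filter.mem_of_superset (isOpen_ball.mem_nhds hball) ball_subset_closedBall)
  have hsd : ContDiffAt ℝ 2 (fun x => areaSq u x ^ (-1 / 2 : ℝ)) x₀ :=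
    hu3x.areaSq.rpow_const_of_ne (hpos x₀).ne'
  have h1 := graphLaplacian_nonneg_of_isLocalMin (u := u) (hsd.sub (hη x₀ hu3x)) hloc
  have h2 : graphLaplacian u (fun x => areaSq u x ^ (-1 / 2 : ℝ) - η x) x₀ = _ :=
    graphLaplacian_sub hsd (hη x₀ hu3x)
  have h3 := graphLaplacian_areaSq_rpow_nonpos hu3x hev
  have h4 := hlap x₀ hball hu3x hev.self_of_nhds hlt
  linarith

theorem areaSq_inv_eq (u : EuclideanSpace ℝ (Fin n) → ℝ) (x : EuclideanSpace ℝ (Fin n)) :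
    (areaSq u x)⁻¹ = (areaSq u x ^ (-1 / 2 : ℝ)) ^ 2 := by
  have hv : 0 ≤ areaSq u x := by linarith [one_le_areaSq u x]
  rw [← Real.rpow_natCast, ← Real.rpow_mul hv, ← Real.rpow_neg_one]
  norm_num

theorem areaSq_le_of_exp_le {a : ℝ} (h : Real.exp (-a) ≤ areaSq u x ^ (-1 / 2 : ℝ)) :
    areaSq u x ≤ Real.exp (2 * a) := by
  have hv : 0 < areaSq u x := by linarith [one_le_areaSq u x]
  have h2 : Real.exp (-a) ^ 2 ≤ (areaSq u x)⁻¹ := by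
    rw [areaSq_inv_eq]
    exact pow_le_pow_left₀ (Real.exp_pos _).le h 2
  rw [← Real.exp_nat_mul, show ((2 : ℕ) : ℝ) * -a = -(2 * a) by push_cast; ring,
    Real.exp_neg] at h2
  exact (inv_le_inv₀ (Real.exp_pos _) hv).1 h2

/-- The gradient estimate when the oscillation is small compared to the radius. -/
theorem areaSq_le_exp_of_small_oscillation (hr : 0 < r) (hrR : r < R) (hn : 1 ≤ n)
    (hu : ContDiffOn ℝ 1 u (ball 0 R))
    (hu3 : ContDiffOn ℝ 3 u (ball 0 R ∩ {x | gradient u x ≠ 0}))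
    (heq : ∀ x ∈ ball (0 : EuclideanSpace ℝ (Fin n)) R, gradient u x ≠ 0 → mcOp u x = 0)
    {L : ℝ} (hL : 0 < L) (hosc : ∀ x ∈ ball (0 : EuclideanSpace ℝ (Fin n)) R, |u x - u 0| ≤ L)
    (hsmall : n * L / r ≤ 1 / 2) : areaSq u 0 ≤ Real.exp (8 * (n * L / r)) := by
  have hn' : (1 : ℝ) ≤ n := by exact_mod_cast hn
  set t := n * L / r with ht
  have ht0 : 0 < t := by positivity
  have hLt : L / r ≤ t := by
    rw [ht]
    gcongr
    nlinarith
  have hsub : closedBall (0 : EuclideanSpace ℝ (Fin n)) r ⊆ ball 0 R := closedBall_subset_ball hrR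
  set l := 1 / (r * L) with hl
  have hl0 : 0 < l := by positivity
  have hlL : l * L ^ 2 = L / r := by
    rw [hl]
    field_simp
  set F : ℝ → ℝ := fun s => (1 - t) * (1 + l * ((s - u 0) ^ 2 - L ^ 2)) with hF
  have hF1 : ∀ s, HasDerivAt F ((1 - t) * (l * (2 * (s - u 0)))) s := fun s => by
    have h := ((((((hasDerivAt_id s).sub_const (u 0)).pow 2).sub_const (L ^ 2)).const_mul
      l).const_add 1).const_mul (1 - t)
    simpa [hF] using h
  have hF2 : ∀ s, HasDerivAt (fun s => (1 - t) * (l * (2 * (s - u 0)))) ((1 - t) * (l * 2)) s :=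
    fun s => by
      have h := ((((hasDerivAt_id s).sub_const (u 0)).const_mul 2).const_mul l).const_mul (1 - t)
      simpa using h
  have hFc : ContDiff ℝ 2 F := by
    rw [hF]
    fun_prop
  have hF_le : ∀ x ∈ closedBall (0 : EuclideanSpace ℝ (Fin n)) r, F (u x) ≤ 1 - t := by
    intro x hx
    have h1 : (u x - u 0) ^ 2 ≤ L ^ 2 := sq_le_sq' (by linarith [abs_le.1 (hosc x (hsub hx))])
      (abs_le.1 (hosc x (hsub hx))).2
    have h2 : l * ((u x - u 0) ^ 2 - L ^ 2) ≤ 0 :=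
      mul_nonpos_of_nonneg_of_nonpos hl0.le (by linarith)
    simp only [hF]
    nlinarith
  set b := (1 - t) / r ^ 2 with hb
  have hb0 : 0 < b := div_pos (by linarith) (by positivity)
  have key := barrier_le_areaSq_rpow (η := fun y => F (u y) - b * ‖y‖ ^ 2) hr hrR hu hu3 heq
    ((hFc.continuous.comp_continuousOn (hu.continuousOn.mono hsub)).sub (by fun_prop))
    (fun x hx => (hFc.contDiffAt.comp x (hx.of_le (by norm_num))).sub
      (contDiff_const_mul_norm_sq b).contDiffAt)
    (fun x hx => by
      have h1 := hF_le x (mem_closedBall_zero_iff.2 hx.le)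
      rw [hx, hb, div_mul_cancel₀ _ (by positivity)]
      linarith)
    (fun x hx => by
      have h1 := hF_le x (ball_subset_closedBall hx)
      have : 0 ≤ b * ‖x‖ ^ 2 := by positivity
      linarith)
    (fun x hx hx3 hmc hlt => by
      have hx2 : ContDiffAt ℝ 2 u x := hx3.of_le (by norm_num)
      rw [graphLaplacian_comp_sub_norm_sq b (Eventually.of_forall hF1) (hF2 _)
        (hFc.contDiffAt.comp x hx2) hx2 hmc]
      have h1 := hF_le x (ball_subset_closedBall hx)
      have hbx : 0 ≤ b * ‖x‖ ^ 2 := by positivity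
      have hs0 : 0 < areaSq u x ^ (-1 / 2 : ℝ) :=
        Real.rpow_pos_of_pos (by linarith [one_le_areaSq u x]) _
      have hs : areaSq u x ^ (-1 / 2 : ℝ) < 1 - t := by linarith
      rw [areaSq_inv_eq]
      set s := areaSq u x ^ (-1 / 2 : ℝ)
      have hs2 : s ^ 2 < 1 - t := by nlinarith
      have hls : n / r ^ 2 < l * (1 - s ^ 2) := by
        have : n / r ^ 2 = l * t := by
          rw [hl, ht]
          field_simp
        rw [this]
        exact mul_lt_mul_of_pos_left (by linarith) hl0
      have : (1 - t) * (l * 2) * (1 - s ^ 2) - 2 * b * (n - 1 + s ^ 2)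
          = 2 * (1 - t) * (l * (1 - s ^ 2) - n / r ^ 2) + 2 * b * (1 - s ^ 2) := by
        rw [hb]
        field_simp
        ring
      rw [this]
      have h3 : 0 < 2 * (1 - t) * (l * (1 - s ^ 2) - n / r ^ 2) :=
        mul_pos (by linarith) (by linarith)
      have h4 : 0 < 2 * b * (1 - s ^ 2) := mul_pos (by linarith) (by linarith)
      linarith)
  have h0 : (1 - t) ^ 2 ≤ areaSq u 0 ^ (-1 / 2 : ℝ) := by
    refine le_trans ?_ key
    simp only [hF, sub_self, norm_zero]
    nlinarith
  have hexp : Real.exp (-(2 * t)) ≤ 1 - t := by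
    rw [Real.exp_neg, inv_le_comm₀ (Real.exp_pos _) (by linarith)]
    refine le_trans ?_ (Real.add_one_le_exp (2 * t))
    rw [inv_le_iff_one_le_mul₀ (by linarith)]
    nlinarith
  have h4 := areaSq_le_of_exp_le (a := 4 * t) (u := u) (x := 0) (by
    refine le_trans ?_ h0
    have h := pow_le_pow_left₀ (Real.exp_pos _).le hexp 2
    rw [← Real.exp_nat_mul] at h
    convert h using 2
    push_cast
    ring)
  convert h4 using 2
  ring

theorem quarter_sq_le_div {b c P X : ℝ} (hb : 0 ≤ b) (hc : 0 ≤ c) (hP : 1 ≤ P) (hX : X ≤ r)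
    (h : 8 * (b * r) ≤ c * P) :
    c ^ 2 / 4 ≤ (c ^ 2 * P ^ 2 - 4 * b * c * P * X) / (1 + P ^ 2) := by
  rw [le_div_iff₀ (by positivity)]
  have h2 : 8 * (b * X) ≤ c * P := le_trans (by gcongr) h
  have h3 : 8 * (b * X) * (c * P) ≤ c * P * (c * P) := by gcongr
  have h4 : 1 ≤ P ^ 2 := by nlinarith
  nlinarith [mul_le_mul_of_nonneg_left h4 (sq_nonneg c)]

theorem exp_neg_le_barrier_at_center {t : ℝ} (ht : 1 / 2 ≤ t) :
    Real.exp (-(132 * t ^ 2)) ≤ Real.exp (-(256 * t ^ 2) / 4) / (1 + 32 * t)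
      * (1 - Real.exp (-(3 * (256 * t ^ 2) / 4))) := by
  have ht2 : 1 / 4 ≤ t ^ 2 := by nlinarith
  have h1 : Real.exp (-(4 * t ^ 2)) ≤ 1 - Real.exp (-(3 * (256 * t ^ 2) / 4)) := by
    have h2 : Real.exp (-(4 * t ^ 2)) ≤ 1 / 2 := by
      rw [Real.exp_neg, one_div, inv_le_inv₀ (Real.exp_pos _) (by norm_num)]
      linarith [Real.add_one_le_exp (4 * t ^ 2)]
    have h3 : Real.exp (-(3 * (256 * t ^ 2) / 4)) ≤ Real.exp (-(4 * t ^ 2)) :=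
      Real.exp_le_exp.2 (by linarith)
    linarith
  have h2 : Real.exp (-(128 * t ^ 2)) ≤ Real.exp (-(256 * t ^ 2) / 4) / (1 + 32 * t) := by
    rw [le_div_iff₀ (by linarith)]
    have h3 : 1 + 32 * t ≤ Real.exp (64 * t ^ 2) := by
      nlinarith [Real.add_one_le_exp (64 * t ^ 2)]
    calc Real.exp (-(128 * t ^ 2)) * (1 + 32 * t)
        ≤ Real.exp (-(128 * t ^ 2)) * Real.exp (64 * t ^ 2) := by gcongr
      _ = Real.exp (-(256 * t ^ 2) / 4) := by
        rw [← Real.exp_add]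
        ring_nf
  calc Real.exp (-(132 * t ^ 2)) = Real.exp (-(128 * t ^ 2)) * Real.exp (-(4 * t ^ 2)) := by
        rw [← Real.exp_add]
        ring_nf
    _ ≤ _ := mul_le_mul h2 h1 (Real.exp_pos _).le
        (div_nonneg (Real.exp_pos _).le (by linarith))

/-- The gradient estimate when the oscillation is large compared to the radius. -/
theorem areaSq_le_exp_of_large_oscillation (hr : 0 < r) (hrR : r < R) (hn : 1 ≤ n)
    (hu : ContDiffOn ℝ 1 u (ball 0 R))
    (hu3 : ContDiffOn ℝ 3 u (ball 0 R ∩ {x | gradient u x ≠ 0}))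
    (heq : ∀ x ∈ ball (0 : EuclideanSpace ℝ (Fin n)) R, gradient u x ≠ 0 → mcOp u x = 0)
    {L : ℝ} (hL : 0 < L) (hosc : ∀ x ∈ ball (0 : EuclideanSpace ℝ (Fin n)) R, |u x - u 0| ≤ L)
    (hlarge : 1 / 2 < n * L / r) : areaSq u 0 ≤ Real.exp (264 * (n * L / r) ^ 2) := by
  have hn' : (1 : ℝ) ≤ n := by exact_mod_cast hn
  set t := n * L / r with ht
  have hLt : L / r ≤ t := by
    rw [ht]
    gcongr
    nlinarith
  have hsub : closedBall (0 : EuclideanSpace ℝ (Fin n)) r ⊆ ball 0 R := closedBall_subset_ball hrR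
  set c := 1 / (4 * L) with hc
  have hc0 : 0 < c := by positivity
  set K := 256 * t ^ 2 with hK
  have hK0 : 64 < K := by nlinarith
  set A := Real.exp (-K / 4) / (1 + 32 * t) with hA
  have hA0 : 0 < A := by positivity
  set b := 1 / r ^ 2 with hb
  have hb0 : 0 < b := by positivity
  set F : ℝ → ℝ := fun s => c * (s - u 0) with hF
  have hF1 : ∀ s, HasDerivAt F c s := fun s => by
    simpa [hF] using ((hasDerivAt_id s).sub_const (u 0)).const_mul c
  have hFc : ContDiff ℝ 2 F := by
    rw [hF]
    fun_prop
  have hF_le : ∀ x ∈ closedBall (0 : EuclideanSpace ℝ (Fin n)) r, F (u x) ≤ 1 / 4 := by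
    intro x hx
    have h1 : c * (u x - u 0) ≤ c * L :=
      mul_le_mul_of_nonneg_left (abs_le.1 (hosc x (hsub hx))).2 hc0.le
    have h2 : c * L = 1 / 4 := by
      rw [hc]
      field_simp
    simp only [hF]
    linarith
  set G : ℝ → ℝ := fun s => A * (Real.exp (K * s) - Real.exp (-(3 * K / 4))) with hG
  have hE : ∀ s, HasDerivAt (fun s => Real.exp (K * s)) (K * Real.exp (K * s)) s := fun s => by
    simpa [mul_comm] using ((hasDerivAt_id s).const_mul K).exp
  have hG1 : ∀ s, HasDerivAt G (A * (K * Real.exp (K * s))) s := fun s =>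
    ((hE s).sub_const _).const_mul A
  have hG2 : ∀ s, HasDerivAt (fun s => A * (K * Real.exp (K * s)))
      (A * (K * (K * Real.exp (K * s)))) s := fun s =>
    ((hE s).const_mul K).const_mul A
  have hGc : ContDiff ℝ 2 G := by
    rw [hG]
    fun_prop
  have hG_le : ∀ s ≤ 1 / 4, G s ≤ 1 / (1 + 32 * t) := by
    intro s hs
    have h1 : Real.exp (K * s) - Real.exp (-(3 * K / 4)) ≤ Real.exp (K / 4) := by
      have := Real.exp_le_exp.2 (show K * s ≤ K / 4 by nlinarith)
      linarith [Real.exp_pos (-(3 * K / 4))]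
    refine (mul_le_mul_of_nonneg_left h1 hA0.le).trans_eq ?_
    rw [hA, div_mul_eq_mul_div, ← Real.exp_add]
    simp [neg_div]
  have hψd : ∀ x, ContDiffAt ℝ 2 u x → ContDiffAt ℝ 2 (fun y => F (u y) - b * ‖y‖ ^ 2) x :=
    fun x hx => (hFc.contDiffAt.comp x hx).sub (contDiff_const_mul_norm_sq b).contDiffAt
  have hψ_le : ∀ x ∈ closedBall (0 : EuclideanSpace ℝ (Fin n)) r,
      F (u x) - b * ‖x‖ ^ 2 ≤ 1 / 4 := by
    intro x hx
    have h1 := hF_le x hx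
    have : 0 ≤ b * ‖x‖ ^ 2 := by positivity
    linarith
  have key := barrier_le_areaSq_rpow (η := fun y => G (F (u y) - b * ‖y‖ ^ 2)) hr hrR hu hu3 heq
    (hGc.continuous.comp_continuousOn
      ((hFc.continuous.comp_continuousOn (hu.continuousOn.mono hsub)).sub (by fun_prop)))
    (fun x hx => hGc.contDiffAt.comp x (hψd x (hx.of_le (by norm_num))))
    (fun x hx => by
      have h1 := hF_le x (mem_closedBall_zero_iff.2 hx.le)
      have h2 : b * ‖x‖ ^ 2 = 1 := by
        rw [hx, hb]
        field_simp
      refine mul_nonpos_of_nonneg_of_nonpos hA0.le (sub_nonpos.2 (Real.exp_le_exp.2 ?_))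
      nlinarith)
    (fun x hx => by
      refine (hG_le _ (hψ_le x (ball_subset_closedBall hx))).trans ?_
      rw [div_le_one (by linarith)]
      linarith)
    (fun x hx hx3 hmc hlt => by
      have hx2 : ContDiffAt ℝ 2 u x := hx3.of_le (by norm_num)
      have hv := one_le_areaSq u x
      have hv0 : 0 < areaSq u x := by linarith
      rw [graphLaplacian_comp (Eventually.of_forall hG1) (hG2 _) (hψd x hx2),
        graphLaplacian_comp_sub_norm_sq b (Eventually.of_forall hF1) (hasDerivAt_const _ c)
          (hFc.contDiffAt.comp x hx2) hx2 hmc]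
      have hq : ∀ i, pd1 (fun y => F (u y) - b * ‖y‖ ^ 2) i x = c * pd1 u i x - 2 * b * x i := by
        intro i
        have hd : DifferentiableAt ℝ (fun y => F (u y)) x :=
          (hFc.contDiffAt.comp x hx2).differentiableAt (by simp)
        rw [pd1_sub hd ((contDiff_const_mul_norm_sq b).contDiffAt.differentiableAt (by simp)),
          pd1_const_mul_norm_sq, pd1_comp (hF1 _) (hx2.differentiableAt (by simp))]
      have hgrad := le_tangential_gradient_sq u x hb0.le hc0.le hq
      set T := ∑ i, pd1 (fun y => F (u y) - b * ‖y‖ ^ 2) i x ^ 2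
        - (∑ i, pd1 u i x * pd1 (fun y => F (u y) - b * ‖y‖ ^ 2) i x) ^ 2 / areaSq u x
      have hs : areaSq u x ^ (-1 / 2 : ℝ) < 1 / (1 + 32 * t) :=
        hlt.trans_le (hG_le _ (hψ_le x (ball_subset_closedBall hx)))
      have hs0 : 0 < areaSq u x ^ (-1 / 2 : ℝ) := Real.rpow_pos_of_pos hv0 _
      have hinv : (areaSq u x)⁻¹ < (1 / (1 + 32 * t)) ^ 2 := by
        rw [areaSq_inv_eq]
        exact pow_lt_pow_left₀ hs hs0.le (by norm_num)
      have hvt : (1 + 32 * t) ^ 2 < areaSq u x := by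
        rw [one_div, inv_pow, inv_lt_inv₀ hv0 (by positivity)] at hinv
        exact hinv
      set P := ‖gradient u x‖
      have hvP : areaSq u x = 1 + P ^ 2 := areaSq_eq u x
      have hP : 32 * t < P := by
        refine lt_of_pow_lt_pow_left₀ 2 (norm_nonneg _) ?_
        nlinarith
      have hxr : ‖x‖ ≤ r := (mem_ball_zero_iff.1 hx).le
      have hT : c ^ 2 / 4 ≤ T := by
        refine le_trans ?_ hgrad
        have h1 : 8 * (b * r) ≤ c * P := by
          have e : 8 * (b * r) = c * (32 * (L / r)) := by
            rw [hb, hc]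
            field_simp
            norm_num
          rw [e]
          exact mul_le_mul_of_nonneg_left (by linarith) hc0.le
        rw [hvP]
        exact quarter_sq_le_div hb0.le hc0.le (by linarith) hxr h1
      have hKT : 4 * n * b ≤ K * T := by
        refine le_trans ?_ (mul_le_mul_of_nonneg_left hT (by linarith))
        have e : K * (c ^ 2 / 4) = 4 * n ^ 2 * b := by
          rw [hK, hc, ht, hb]
          field_simp
          norm_num
        rw [e]
        gcongr
        nlinarith
      have hinv1 : (areaSq u x)⁻¹ ≤ 1 := inv_le_one_of_one_le₀ hv
      have hAK : 0 < A * (K * Real.exp (K * (F (u x) - b * ‖x‖ ^ 2))) :=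
        mul_pos hA0 (mul_pos (by linarith) (Real.exp_pos _))
      have hfin : 0 < K * T - 2 * b * (n - 1 + (areaSq u x)⁻¹) := by
        have h1 : b * (n - 1 + (areaSq u x)⁻¹) ≤ b * n :=
          mul_le_mul_of_nonneg_left (by linarith) hb0.le
        have h2 : 0 < b * n := mul_pos hb0 (by linarith)
        linarith
      have := mul_pos hAK hfin
      refine this.trans_eq ?_
      ring)
  have h0 : Real.exp (-(132 * t ^ 2)) ≤ areaSq u 0 ^ (-1 / 2 : ℝ) := by
    refine le_trans ?_ key
    have e : G (F (u 0) - b * ‖(0 : EuclideanSpace ℝ (Fin n))‖ ^ 2)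
        = A * (1 - Real.exp (-(3 * K / 4))) := by
      simp [hG, hF]
    simp only [e]
    exact exp_neg_le_barrier_at_center hlarge.le
  have h4 := areaSq_le_of_exp_le h0
  convert h4 using 2
  ring

end MinimalSurface

/-- Theorem 1.1 (e): interior gradient estimate for the minimal
surface equation, in terms of the oscillation `L`. -/
theorem gradient_estimate_minimal_surface (n : ℕ) (hn : 1 ≤ n) :
    ∃ C > 0, ∀ R : ℝ, 0 < R →
      ∀ u : EuclideanSpace ℝ (Fin n) → ℝ,
        ContDiffOn ℝ 1 u (ball 0 R) →
        ContDiffOn ℝ 3 u (ball 0 R ∩ {x | gradient u x ≠ 0}) →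
        (∀ x ∈ ball (0 : EuclideanSpace ℝ (Fin n)) R, gradient u x ≠ 0 →
          mcOp u x = 0) →
        ∀ L : ℝ,
          (∀ x ∈ ball (0 : EuclideanSpace ℝ (Fin n)) R,
            ∀ y ∈ ball (0 : EuclideanSpace ℝ (Fin n)) R, |u x - u y| ≤ L) →
          ‖gradient u 0‖ ^ 2 ≤
            max (Real.exp (C * L ^ 2 / R ^ 2) - 1) (Real.exp (C * L / R) - 1) := by
  have hn' : (1 : ℝ) ≤ n := by exact_mod_cast hn
  refine ⟨1056 * (n : ℝ) ^ 2, by positivity, fun R hR u hu hu3 heq L hosc => ?_⟩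
  have h0 : (0 : EuclideanSpace ℝ (Fin n)) ∈ ball 0 R := mem_ball_self hR
  have hosc0 : ∀ x ∈ ball (0 : EuclideanSpace ℝ (Fin n)) R, |u x - u 0| ≤ L := fun x hx =>
    hosc x hx 0 h0
  have hL0 : 0 ≤ L := (abs_nonneg _).trans (hosc0 0 h0)
  have hr : 0 < R / 2 := by linarith
  have hrR : R / 2 < R := by linarith
  have hnorm : ‖gradient u 0‖ ^ 2 = areaSq u 0 - 1 := by rw [areaSq_eq]; ring
  rcases hL0.eq_or_lt with rfl | hL
  · have hev : u =ᶠ[nhds 0] fun _ => u 0 := by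
      filter_upwards [isOpen_ball.mem_nhds h0] with x hx
      exact sub_eq_zero.1 (abs_nonpos_iff.1 (hosc0 x hx))
    have hg : gradient u 0 = 0 := by
      rw [gradient, hev.fderiv_eq]
      simp
    simp [hg]
  rw [hnorm]
  rcases le_or_gt (n * L / (R / 2)) (1 / 2) with hs | hs
  · refine le_max_of_le_right (sub_le_sub_right ?_ 1)
    refine (areaSq_le_exp_of_small_oscillation hr hrR hn hu hu3 heq hL hosc0 hs).trans ?_
    refine Real.exp_le_exp.2 ?_
    have e : 8 * (n * L / (R / 2)) = 16 * n * L / R := by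
      field_simp
      norm_num
    rw [e]
    gcongr
    · norm_num
    · nlinarith
  · refine le_max_of_le_left (sub_le_sub_right ?_ 1)
    refine (areaSq_le_exp_of_large_oscillation hr hrR hn hu hu3 heq hL hosc0 hs).trans ?_
    refine Real.exp_le_exp.2 (le_of_eq ?_)
    field_simp
    norm_num
end

section
/- Let n ≥ 1 and let u : ℝⁿ → ℝ be C¹ on ℝⁿ and C³ on {|∇u| > 0}, satisfying the minimal surface equation div(∇u/√(1+|∇u|²)) = 0 on all of ℝⁿ. If u grows less than linearly, i.e. |u(x)| / |x| → 0 as |x| → ∞, then u is constant. -/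
open Metric Real Filter

section SecondVariation

open scoped Topology RealInnerProductSpace

theorem IsLocalMax.second_deriv_nonpos {f f' : ℝ → ℝ} {c : ℝ} (hmax : IsLocalMax f 0)
    (hf : ∀ᶠ t in 𝓝 0, HasDerivAt f (f' t) t) (hf' : HasDerivAt f' c 0) : c ≤ 0 := by
  by_contra! hc
  have hd : deriv f =ᶠ[𝓝 0] f' := hf.mono fun t ht => ht.deriv
  have hdd : deriv (deriv f) 0 = c := by rw [hd.deriv_eq, hf'.deriv]
  have hmin : IsLocalMin f 0 :=
    isLocalMin_of_deriv_deriv_pos (hdd ▸ hc) hmax.deriv_eq_zero hf.self_of_nhds.continuousAt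
  have hconst : f =ᶠ[𝓝 0] fun _ => f 0 := by
    filter_upwards [hmax, hmin] with t h1 h2 using le_antisymm h1 h2
  have h0 : deriv f =ᶠ[𝓝 0] fun _ => 0 := by
    filter_upwards [hconst.eventuallyEq_nhds] with t ht
    rw [ht.deriv_eq]; simp
  rw [h0.deriv_eq] at hdd
  simp at hdd
  exact hc.ne hdd

variable {n : ℕ}

theorem sum_coord_sq (p : EuclideanSpace ℝ (Fin n)) : ∑ k, p k * p k = ‖p‖ ^ 2 := by
  rw [EuclideanSpace.real_norm_sq_eq]
  exact Finset.sum_congr rfl fun _ _ => (sq _).symm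

theorem sum_coord_mul (p q : EuclideanSpace ℝ (Fin n)) : ∑ k, p k * q k = ⟪p, q⟫ := by
  rw [PiLp.inner_apply]
  exact Finset.sum_congr rfl fun _ _ => by simp [mul_comm]

theorem sum_coord_smul_single (p : EuclideanSpace ℝ (Fin n)) :
    ∑ k, p k • EuclideanSpace.single k (1 : ℝ) = p := by
  ext i
  simp [Pi.single_apply]

theorem sum_coord_mul_apply (f : EuclideanSpace ℝ (Fin n) →L[ℝ] ℝ)
    (p : EuclideanSpace ℝ (Fin n)) : ∑ k, p k * f (EuclideanSpace.single k 1) = f p := by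
  conv_rhs => rw [← sum_coord_smul_single p]
  simp only [map_sum, map_smul, smul_eq_mul]

theorem sum_bilin_sub_smul
    (B : EuclideanSpace ℝ (Fin n) →L[ℝ] EuclideanSpace ℝ (Fin n) →L[ℝ] ℝ)
    (p : EuclideanSpace ℝ (Fin n)) (μ : ℝ) :
    ∑ k, B (EuclideanSpace.single k 1 - (μ * p k) • p)
        (EuclideanSpace.single k 1 - (μ * p k) • p)
      = ∑ k, B (EuclideanSpace.single k 1) (EuclideanSpace.single k 1)
        - (2 * μ - μ ^ 2 * ‖p‖ ^ 2) * B p p := by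
  have h1 : ∑ k, p k * B (EuclideanSpace.single k 1) p = B p p :=
    sum_coord_mul_apply (B.flip p) p
  have h2 : ∑ k, p k * B p (EuclideanSpace.single k 1) = B p p :=
    sum_coord_mul_apply (B p) p
  have h3 := sum_coord_sq p
  have key : ∀ k, B (EuclideanSpace.single k 1 - (μ * p k) • p)
        (EuclideanSpace.single k 1 - (μ * p k) • p)
      = B (EuclideanSpace.single k 1) (EuclideanSpace.single k 1)
        - μ * (p k * B (EuclideanSpace.single k 1) p)
        - μ * (p k * B p (EuclideanSpace.single k 1)) + μ ^ 2 * B p p * (p k * p k) := by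
    intro k
    simp only [map_sub, map_smul, _root_.sub_apply, _root_.smul_apply,
      smul_eq_mul]
    ring
  simp only [key, Finset.sum_add_distrib, Finset.sum_sub_distrib, ← Finset.mul_sum, h1, h2, h3]
  ring

theorem sum_norm_sq_sub_smul (p : EuclideanSpace ℝ (Fin n)) (μ : ℝ) :
    ∑ k, ‖EuclideanSpace.single k 1 - (μ * p k) • p‖ ^ 2
      = n - (2 * μ - μ ^ 2 * ‖p‖ ^ 2) * ‖p‖ ^ 2 := by
  have h := sum_bilin_sub_smul (innerSL ℝ) p μ
  simp only [innerSL_apply_apply ℝ, real_inner_self_eq_norm_sq] at h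
  simpa using h

theorem inner_gradient (u : EuclideanSpace ℝ (Fin n) → ℝ) (x v : EuclideanSpace ℝ (Fin n)) :
    ⟪gradient u x, v⟫ = fderiv ℝ u x v := by
  rw [← toDual_gradient, InnerProductSpace.toDual_apply_apply]

theorem gradient_apply_eq_pd1 {u : EuclideanSpace ℝ (Fin n) → ℝ} (x : EuclideanSpace ℝ (Fin n))
    (i : Fin n) : gradient u x i = pd1 u i x := by
  rw [pd1, ← inner_gradient, EuclideanSpace.inner_single_right]
  simp

theorem pd2_eq {u : EuclideanSpace ℝ (Fin n) → ℝ} {x : EuclideanSpace ℝ (Fin n)}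
    (h : DifferentiableAt ℝ (fderiv ℝ u) x) (i j : Fin n) :
    pd2 u i j x
      = fderiv ℝ (fderiv ℝ u) x (EuclideanSpace.single i 1) (EuclideanSpace.single j 1) := by
  have : HasFDerivAt (pd1 u j)
      ((ContinuousLinearMap.apply ℝ ℝ (EuclideanSpace.single j 1)).comp
        (fderiv ℝ (fderiv ℝ u) x)) x := by
    have := (ContinuousLinearMap.apply ℝ ℝ
      (EuclideanSpace.single j (1 : ℝ))).hasFDerivAt.comp x h.hasFDerivAt
    exact this
  rw [pd2, this.fderiv]; rfl

theorem mcOp_eq {u : EuclideanSpace ℝ (Fin n) → ℝ} {x : EuclideanSpace ℝ (Fin n)}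
    (h : DifferentiableAt ℝ (fderiv ℝ u) x) :
    mcOp u x = ∑ k, fderiv ℝ (fderiv ℝ u) x (EuclideanSpace.single k 1) (EuclideanSpace.single k 1)
      - fderiv ℝ (fderiv ℝ u) x (gradient u x) (gradient u x) / (1 + ‖gradient u x‖ ^ 2) := by
  set B := fderiv ℝ (fderiv ℝ u) x
  set p := gradient u x with hp
  have h1 : ∑ i, ∑ j, p i * p j * B (EuclideanSpace.single i 1) (EuclideanSpace.single j 1)
      = B p p := by
    simp_rw [mul_assoc, ← Finset.mul_sum, sum_coord_mul_apply]
    exact sum_coord_mul_apply (B.flip p) p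
  have key : ∀ i j, aCoef u i j x * pd2 u i j x
      = (if i = j then B (EuclideanSpace.single i 1) (EuclideanSpace.single j 1) else 0)
        - (p i * p j * B (EuclideanSpace.single i 1) (EuclideanSpace.single j 1))
          / (1 + ‖p‖ ^ 2) := by
    intro i j
    rw [aCoef, pd2_eq h, ← gradient_apply_eq_pd1, ← gradient_apply_eq_pd1]
    split_ifs <;> ring
  simp only [mcOp, key, Finset.sum_sub_distrib, ← Finset.sum_div, h1]
  simp

/-- A frame adapted to the nondivergence operator: `∑ ξ_k ⊗ ξ_k = a`. -/
theorem sum_frame_eq_mcOp {u : EuclideanSpace ℝ (Fin n) → ℝ} {x : EuclideanSpace ℝ (Fin n)}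
    (h : DifferentiableAt ℝ (fderiv ℝ u) x) {p : EuclideanSpace ℝ (Fin n)}
    (hp : gradient u x = p) {μ ν : ℝ}
    (hμν : 2 * μ - μ ^ 2 * ‖p‖ ^ 2 - ν ^ 2 = 1 / (1 + ‖p‖ ^ 2)) :
    ∑ k, fderiv ℝ (fderiv ℝ u) x (EuclideanSpace.single k 1 - (μ * p k) • p)
        (EuclideanSpace.single k 1 - (μ * p k) • p)
      + fderiv ℝ (fderiv ℝ u) x (ν • p) (ν • p) = mcOp u x := by
  rw [mcOp_eq h, sum_bilin_sub_smul, hp]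
  simp only [map_smul, _root_.smul_apply, smul_eq_mul]
  rw [div_eq_mul_one_div, ← hμν]
  ring


theorem frame_difference_real {a s r μ ν m : ℝ} (hs : 0 < s) (hr : 0 ≤ r)
    (hras : r ^ 2 ≤ a * s) (hμ : μ = 1 / (1 + a)) (hν : ν = 1 / (1 + s)) (hm : m = 2 / s - ν) :
    1 / (1 + s) ≤ (m ^ 2 * s ^ 3 - 2 * μ * m * r ^ 2 * s + μ ^ 2 * r ^ 2 * a
      + (μ * r + ν * s) ^ 2) / s ∧
    m ^ 2 * s ^ 2 - 2 * μ * m * r ^ 2 + μ ^ 2 * a ^ 2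
      + (μ ^ 2 * a + 2 * μ * ν * r + ν ^ 2 * s)
      - (m ^ 2 * s ^ 3 - 2 * μ * m * r ^ 2 * s + μ ^ 2 * r ^ 2 * a
      + (μ * r + ν * s) ^ 2) / s = (a - r ^ 2 / s) / (1 + a) := by
  have ha : 0 ≤ a := by
    by_contra! h
    nlinarith [sq_nonneg r, mul_neg_of_neg_of_pos h hs]
  have hμ1 : μ * (1 + a) = 1 := by rw [hμ]; field_simp
  have hν1 : ν * (1 + s) = 1 := by rw [hν]; field_simp
  have hm1 : m * s = 2 - ν * s := by rw [hm]; field_simp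
  have hμ0 : 0 < μ := by rw [hμ]; positivity
  have hν0 : 0 < ν := by rw [hν]; positivity
  constructor
  · rw [le_div_iff₀ hs, ← hν]
    have hρ : μ * r ^ 2 ≤ s := by
      calc μ * r ^ 2 ≤ μ * (a * s) := by gcongr
        _ = s - μ * s := by linear_combination s * hμ1
        _ ≤ s := by nlinarith
    have h1 : (μ * r ^ 2) ^ 2 ≤ μ ^ 2 * r ^ 2 * a * s := by
      nlinarith [mul_le_mul_of_nonneg_left hras (by positivity : 0 ≤ μ ^ 2 * r ^ 2)]
    have h2 : s * ν ≤ s * (2 - ν * s) - μ * r ^ 2 := by nlinarith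
    have h3 : (s * ν) ^ 2 ≤ (s * (2 - ν * s) - μ * r ^ 2) ^ 2 :=
      pow_le_pow_left₀ (by positivity) h2 2
    have h4 : s * ν ^ 2 ≤ m ^ 2 * s ^ 3 - 2 * μ * m * r ^ 2 * s + μ ^ 2 * r ^ 2 * a := by
      refine le_of_mul_le_mul_left ?_ hs
      have e : s * (m ^ 2 * s ^ 3 - 2 * μ * m * r ^ 2 * s + μ ^ 2 * r ^ 2 * a)
          = (s * (m * s)) ^ 2 - 2 * μ * r ^ 2 * (s * (m * s)) + μ ^ 2 * r ^ 2 * a * s := by ring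
      rw [e, hm1]
      nlinarith
    have h5 : (ν * s) ^ 2 ≤ (μ * r + ν * s) ^ 2 :=
      pow_le_pow_left₀ (by positivity) (by nlinarith [mul_nonneg hμ0.le hr]) 2
    have h6 : ν * s = s * ν ^ 2 + (ν * s) ^ 2 := by linear_combination (-(ν * s)) * hν1
    linarith
  · rw [hμ]
    field_simp
    ring

/-- The coupled second variation of a function of `x - y` along the frames of `sum_frame_eq_mcOp`
at two points with gradients `p` and `q`, where `q` is parallel to `x - y`. -/
theorem frame_difference_bound {p q : EuclideanSpace ℝ (Fin n)} (hq : q ≠ 0)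
    (hpq : 0 ≤ ⟪q, p⟫) {c D μ ν m : ℝ} (hc : 0 ≤ c) (hD : D ≤ 0)
    (hμ : μ = 1 / (1 + ‖p‖ ^ 2)) (hν : ν = 1 / (1 + ‖q‖ ^ 2)) (hm : m = 2 / ‖q‖ ^ 2 - ν) :
    ∑ k, ((D - c) / ‖q‖ ^ 2 * ⟪q, (m * q k) • q - (μ * p k) • p⟫ ^ 2
        + c * ‖(m * q k) • q - (μ * p k) • p‖ ^ 2)
      + ((D - c) / ‖q‖ ^ 2 * ⟪q, μ • p + ν • q⟫ ^ 2 + c * ‖μ • p + ν • q‖ ^ 2)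
      ≤ D / (1 + ‖q‖ ^ 2) + c * ‖p - q‖ ^ 2 / (1 + ‖p‖ ^ 2) := by
  have hs : 0 < ‖q‖ ^ 2 := by positivity
  have hcs : ⟪q, p⟫ ^ 2 ≤ ‖p‖ ^ 2 * ‖q‖ ^ 2 := by
    rw [← mul_pow, sq_le_sq₀ hpq (by positivity), mul_comm]
    exact real_inner_le_norm q p
  have hk : ‖p - q‖ ^ 2 = ‖p‖ ^ 2 - 2 * ⟪q, p⟫ + ‖q‖ ^ 2 := by
    rw [norm_sub_sq_real, real_inner_comm]
  have i1 : ∀ α β : ℝ, ⟪q, α • q - β • p⟫ = α * ‖q‖ ^ 2 - β * ⟪q, p⟫ := by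
    intro α β
    rw [inner_sub_right, inner_smul_right, inner_smul_right, real_inner_self_eq_norm_sq]
  have i2 : ∀ α β : ℝ, ‖α • q - β • p‖ ^ 2
      = α ^ 2 * ‖q‖ ^ 2 - 2 * α * β * ⟪q, p⟫ + β ^ 2 * ‖p‖ ^ 2 := by
    intro α β
    rw [norm_sub_sq_real, inner_smul_left, inner_smul_right, norm_smul, norm_smul, mul_pow,
      mul_pow, Real.norm_eq_abs, Real.norm_eq_abs, sq_abs, sq_abs]
    simp only [conj_trivial]
    ring
  have i3 : μ • p + ν • q = ν • q - (-μ) • p := by module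
  have c1 := sum_coord_sq p
  have c2 := sum_coord_sq q
  have c3 := sum_coord_mul q p
  obtain ⟨h1, h2⟩ := frame_difference_real hs hpq hcs hμ hν hm
  rw [i3]
  simp only [i1, i2]
  set s := ‖q‖ ^ 2
  set a := ‖p‖ ^ 2
  set r := ⟪q, p⟫
  set T := (m ^ 2 * s ^ 3 - 2 * μ * m * r ^ 2 * s + μ ^ 2 * r ^ 2 * a
      + (μ * r + ν * s) ^ 2) / s with hT
  have key : ∀ k, (D - c) / s * (m * q k * s - μ * p k * r) ^ 2
        + c * ((m * q k) ^ 2 * s - 2 * (m * q k) * (μ * p k) * r + (μ * p k) ^ 2 * a)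
      = ((D - c) / s * m ^ 2 * s ^ 2 + c * m ^ 2 * s) * (q k * q k)
        + (-2 * ((D - c) / s) * m * μ * r * s - 2 * c * m * μ * r) * (q k * p k)
        + ((D - c) / s * μ ^ 2 * r ^ 2 + c * μ ^ 2 * a) * (p k * p k) := by
    intro k; ring
  simp only [key, Finset.sum_add_distrib, ← Finset.mul_sum, c1, c2, c3]
  have e : ((D - c) / s * m ^ 2 * s ^ 2 + c * m ^ 2 * s) * s
        + (-2 * ((D - c) / s) * m * μ * r * s - 2 * c * m * μ * r) * r
        + ((D - c) / s * μ ^ 2 * r ^ 2 + c * μ ^ 2 * a) * a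
        + ((D - c) / s * (ν * s - -μ * r) ^ 2
          + c * (ν ^ 2 * s - 2 * ν * -μ * r + (-μ) ^ 2 * a))
      = D * T + c * ((a - r ^ 2 / s) / (1 + a)) := by
    rw [← h2, hT]; ring
  rw [e]
  have hak : a - r ^ 2 / s ≤ ‖p - q‖ ^ 2 := by
    rw [hk, sub_le_iff_le_add]
    have : 0 ≤ (r - s) ^ 2 / s := by positivity
    have e2 : (r - s) ^ 2 / s = r ^ 2 / s - 2 * r + s := by field_simp; ring
    linarith
  have g1 : D * T ≤ D / (1 + s) := by
    rw [div_eq_mul_one_div]; exact mul_le_mul_of_nonpos_left h1 hD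
  have g2 : c * ((a - r ^ 2 / s) / (1 + a)) ≤ c * ‖p - q‖ ^ 2 / (1 + a) := by
    rw [mul_div_assoc]; gcongr
  linarith

section Doubling

variable {u : EuclideanSpace ℝ (Fin n) → ℝ} {h h' : ℝ → ℝ} {h2 K : ℝ}
  {z x₀ y₀ : EuclideanSpace ℝ (Fin n)}

theorem hasDerivAt_comp_line (hu : Differentiable ℝ u) (x ξ : EuclideanSpace ℝ (Fin n)) (t : ℝ) :
    HasDerivAt (fun t : ℝ => u (x + t • ξ)) (fderiv ℝ u (x + t • ξ) ξ) t := by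
  have hl : HasDerivAt (fun t : ℝ => x + t • ξ) ξ t := by
    simpa using ((hasDerivAt_id t).smul_const ξ).const_add x
  exact (hu _).hasFDerivAt.comp_hasDerivAt t hl

theorem hasDerivAt_fderiv_comp_line {x : EuclideanSpace ℝ (Fin n)}
    (hu : DifferentiableAt ℝ (fderiv ℝ u) x) (ξ : EuclideanSpace ℝ (Fin n)) :
    HasDerivAt (fun t : ℝ => fderiv ℝ u (x + t • ξ) ξ) (fderiv ℝ (fderiv ℝ u) x ξ ξ) 0 := by
  have hl : HasDerivAt (fun t : ℝ => x + t • ξ) ξ 0 := by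
    simpa using ((hasDerivAt_id (0 : ℝ)).smul_const ξ).const_add x
  have hu' : HasFDerivAt (fderiv ℝ u) (fderiv ℝ (fderiv ℝ u) x) (x + (0 : ℝ) • ξ) := by
    simpa using hu.hasFDerivAt
  have h1 : HasDerivAt (fun t : ℝ => fderiv ℝ u (x + t • ξ)) (fderiv ℝ (fderiv ℝ u) x ξ) 0 :=
    hu'.comp_hasDerivAt 0 hl
  have h2 := (ContinuousLinearMap.apply ℝ ℝ ξ).hasFDerivAt.comp_hasDerivAt 0 h1
  exact h2

theorem isLocalMax_comp_line
    (hmax : IsLocalMax (fun P : EuclideanSpace ℝ (Fin n) × EuclideanSpace ℝ (Fin n) =>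
      u P.1 - u P.2 - h (‖P.1 - P.2‖ ^ 2) - K * ‖P.1 - z‖ ^ 2) (x₀, y₀))
    (ξ ζ : EuclideanSpace ℝ (Fin n)) :
    IsLocalMax (fun t : ℝ => u (x₀ + t • ξ) - u (y₀ + t • ζ)
      - h (‖(x₀ + t • ξ) - (y₀ + t • ζ)‖ ^ 2) - K * ‖x₀ + t • ξ - z‖ ^ 2) 0 := by
  have hc : ContinuousAt (fun t : ℝ => (x₀ + t • ξ, y₀ + t • ζ)) 0 := by fun_prop
  have hmax' : IsLocalMax (fun P : EuclideanSpace ℝ (Fin n) × EuclideanSpace ℝ (Fin n) =>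
      u P.1 - u P.2 - h (‖P.1 - P.2‖ ^ 2) - K * ‖P.1 - z‖ ^ 2)
      ((fun t : ℝ => (x₀ + t • ξ, y₀ + t • ζ)) 0) := by simpa using hmax
  exact hc.eventually hmax'

theorem hasDerivAt_norm_sq_line (x ξ : EuclideanSpace ℝ (Fin n)) (t : ℝ) :
    HasDerivAt (fun t : ℝ => ‖x + t • ξ‖ ^ 2) (2 * ⟪x + t • ξ, ξ⟫) t := by
  have hl : HasDerivAt (fun t : ℝ => x + t • ξ) ξ t := by
    simpa using ((hasDerivAt_id t).smul_const ξ).const_add x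
  exact hl.norm_sq

theorem hasDerivAt_inner_line (x ξ : EuclideanSpace ℝ (Fin n)) (t : ℝ) :
    HasDerivAt (fun t : ℝ => ⟪x + t • ξ, ξ⟫) (‖ξ‖ ^ 2) t := by
  have hl : HasDerivAt (fun t : ℝ => x + t • ξ) ξ t := by
    simpa using ((hasDerivAt_id t).smul_const ξ).const_add x
  simpa [real_inner_self_eq_norm_sq] using hl.inner ℝ (hasDerivAt_const t ξ)

theorem hasDerivAt_doubling_line (hu : Differentiable ℝ u)
    (hh : ∀ q > 0, HasDerivAt h (h' q) q) (ξ ζ : EuclideanSpace ℝ (Fin n)) {t : ℝ}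
    (hne : x₀ - y₀ + t • (ξ - ζ) ≠ 0) :
    HasDerivAt (fun t : ℝ => u (x₀ + t • ξ) - u (y₀ + t • ζ)
      - h (‖(x₀ + t • ξ) - (y₀ + t • ζ)‖ ^ 2) - K * ‖x₀ + t • ξ - z‖ ^ 2)
      (fderiv ℝ u (x₀ + t • ξ) ξ - fderiv ℝ u (y₀ + t • ζ) ζ
        - h' (‖x₀ - y₀ + t • (ξ - ζ)‖ ^ 2) * (2 * ⟪x₀ - y₀ + t • (ξ - ζ), ξ - ζ⟫)
        - K * (2 * ⟪x₀ - z + t • ξ, ξ⟫)) t := by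
  have e1 : ∀ t : ℝ, (x₀ + t • ξ) - (y₀ + t • ζ) = x₀ - y₀ + t • (ξ - ζ) := fun t => by module
  have e2 : ∀ t : ℝ, x₀ + t • ξ - z = x₀ - z + t • ξ := fun t => by module
  simp only [e1, e2]
  have hN := hasDerivAt_norm_sq_line (x₀ - y₀) (ξ - ζ) t
  exact (((hasDerivAt_comp_line hu x₀ ξ t).sub (hasDerivAt_comp_line hu y₀ ζ t)).sub
    ((hh _ (by positivity)).comp t hN)).sub ((hasDerivAt_norm_sq_line (x₀ - z) ξ t).const_mul K)

theorem first_variation (hu : Differentiable ℝ u) (hne : x₀ ≠ y₀)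
    (hmax : IsLocalMax (fun P : EuclideanSpace ℝ (Fin n) × EuclideanSpace ℝ (Fin n) =>
      u P.1 - u P.2 - h (‖P.1 - P.2‖ ^ 2) - K * ‖P.1 - z‖ ^ 2) (x₀, y₀))
    (hh : ∀ q > 0, HasDerivAt h (h' q) q) :
    gradient u x₀ = (2 * h' (‖x₀ - y₀‖ ^ 2)) • (x₀ - y₀) + (2 * K) • (x₀ - z) ∧
      gradient u y₀ = (2 * h' (‖x₀ - y₀‖ ^ 2)) • (x₀ - y₀) := by
  have key : ∀ ξ ζ, fderiv ℝ u x₀ ξ - fderiv ℝ u y₀ ζ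
      - h' (‖x₀ - y₀‖ ^ 2) * (2 * ⟪x₀ - y₀, ξ - ζ⟫) - K * (2 * ⟪x₀ - z, ξ⟫) = 0 := by
    intro ξ ζ
    have hd := hasDerivAt_doubling_line (z := z) (K := K) hu hh ξ ζ (x₀ := x₀) (y₀ := y₀) (t := 0)
      (by simpa [sub_eq_zero] using hne)
    simpa using (isLocalMax_comp_line hmax ξ ζ).hasDerivAt_eq_zero hd
  constructor
  · refine ext_inner_right ℝ fun ξ => ?_
    have := key ξ 0
    rw [inner_gradient, inner_add_left, inner_smul_left, inner_smul_left]
    simp at this ⊢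
    linarith
  · refine ext_inner_right ℝ fun ζ => ?_
    have := key 0 ζ
    rw [inner_gradient, inner_smul_left]
    simp [inner_neg_right] at this ⊢
    linarith

theorem second_variation (hu : Differentiable ℝ u) (hne : x₀ ≠ y₀)
    (hmax : IsLocalMax (fun P : EuclideanSpace ℝ (Fin n) × EuclideanSpace ℝ (Fin n) =>
      u P.1 - u P.2 - h (‖P.1 - P.2‖ ^ 2) - K * ‖P.1 - z‖ ^ 2) (x₀, y₀))
    (hh : ∀ q > 0, HasDerivAt h (h' q) q) (hh2 : HasDerivAt h' h2 (‖x₀ - y₀‖ ^ 2))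
    (hx : DifferentiableAt ℝ (fderiv ℝ u) x₀) (hy : DifferentiableAt ℝ (fderiv ℝ u) y₀)
    (ξ ζ : EuclideanSpace ℝ (Fin n)) :
    fderiv ℝ (fderiv ℝ u) x₀ ξ ξ - fderiv ℝ (fderiv ℝ u) y₀ ζ ζ
      ≤ 4 * h2 * ⟪x₀ - y₀, ξ - ζ⟫ ^ 2 + 2 * h' (‖x₀ - y₀‖ ^ 2) * ‖ξ - ζ‖ ^ 2
        + 2 * K * ‖ξ‖ ^ 2 := by
  have hcont : ContinuousAt (fun t : ℝ => x₀ - y₀ + t • (ξ - ζ)) 0 := by fun_prop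
  have hev : ∀ᶠ t : ℝ in 𝓝 0, x₀ - y₀ + t • (ξ - ζ) ≠ 0 :=
    hcont.eventually_ne (by simpa [sub_eq_zero] using hne)
  have hN : HasDerivAt (fun t : ℝ => ‖x₀ - y₀ + t • (ξ - ζ)‖ ^ 2) (2 * ⟪x₀ - y₀, ξ - ζ⟫) 0 := by
    simpa using hasDerivAt_norm_sq_line (x₀ - y₀) (ξ - ζ) 0
  have hh2' : HasDerivAt h' h2 (‖x₀ - y₀ + (0 : ℝ) • (ξ - ζ)‖ ^ 2) := by simpa using hh2
  have hd := (((hasDerivAt_fderiv_comp_line hx ξ).sub (hasDerivAt_fderiv_comp_line hy ζ)).sub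
    ((hh2'.comp 0 hN).mul ((hasDerivAt_inner_line (x₀ - y₀) (ξ - ζ) 0).const_mul 2))).sub
    (((hasDerivAt_inner_line (x₀ - z) ξ 0).const_mul 2).const_mul K)
  have := (isLocalMax_comp_line hmax ξ ζ).second_deriv_nonpos
    (hev.mono fun t ht => hasDerivAt_doubling_line (z := z) (K := K) hu hh ξ ζ ht) hd
  simp at this
  nlinarith

theorem contact_inequality (hu1 : ContDiff ℝ 1 u)
    (hu3 : ContDiffOn ℝ 3 u {x | gradient u x ≠ 0})
    (heq : ∀ x : EuclideanSpace ℝ (Fin n), gradient u x ≠ 0 → mcOp u x = 0)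
    (hK : 0 ≤ K) (hne : x₀ ≠ y₀)
    (hmax : IsLocalMax (fun P : EuclideanSpace ℝ (Fin n) × EuclideanSpace ℝ (Fin n) =>
      u P.1 - u P.2 - h (‖P.1 - P.2‖ ^ 2) - K * ‖P.1 - z‖ ^ 2) (x₀, y₀))
    (hh : ∀ q > 0, HasDerivAt h (h' q) q) (hh2 : HasDerivAt h' h2 (‖x₀ - y₀‖ ^ 2))
    (hpos : 0 < h' (‖x₀ - y₀‖ ^ 2))
    (hk : (2 * K) ^ 2 * ‖x₀ - z‖ ^ 2 ≤ h' (‖x₀ - y₀‖ ^ 2) ^ 2 * ‖x₀ - y₀‖ ^ 2)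
    (hconc : 4 * h2 * ‖x₀ - y₀‖ ^ 2 + 2 * h' (‖x₀ - y₀‖ ^ 2) ≤ 0) :
    -(4 * h2 * ‖x₀ - y₀‖ ^ 2 + 2 * h' (‖x₀ - y₀‖ ^ 2))
      ≤ 8 * h' (‖x₀ - y₀‖ ^ 2) * ((2 * K) ^ 2 * ‖x₀ - z‖ ^ 2)
        + 2 * K * n * (1 + 4 * h' (‖x₀ - y₀‖ ^ 2) ^ 2 * ‖x₀ - y₀‖ ^ 2) := by
  have hu : Differentiable ℝ u := hu1.differentiable one_ne_zero
  obtain ⟨hp, hq⟩ := first_variation hu hne hmax hh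
  have hopen : IsOpen {x | gradient u x ≠ 0} := by
    have : Continuous (gradient u) :=
      (InnerProductSpace.toDual ℝ _).symm.continuous.comp (hu1.continuous_fderiv one_ne_zero)
    exact isOpen_ne_fun this continuous_const
  have hdiff : ∀ x, gradient u x ≠ 0 → DifferentiableAt ℝ (fderiv ℝ u) x := fun x hx =>
    (((hu3.contDiffAt (hopen.mem_nhds hx)).fderiv_right (m := 1) (by norm_num)).differentiableAt
      one_ne_zero)
  have hsv := second_variation hu hne hmax hh hh2
  set p := gradient u x₀
  set q := gradient u y₀
  set d := ‖x₀ - y₀‖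
  set c := 2 * h' (d ^ 2) with hc
  have hd : 0 < d := norm_pos_iff.2 (sub_ne_zero.2 hne)
  have hc0 : 0 < c := by positivity
  have hqn : ‖q‖ = c * d := by rw [hq, norm_smul, Real.norm_of_nonneg hc0.le]
  have hkn : ‖p - q‖ ^ 2 = (2 * K) ^ 2 * ‖x₀ - z‖ ^ 2 := by
    rw [hp, hq, add_sub_cancel_left, norm_smul, mul_pow, Real.norm_eq_abs, sq_abs]
  have hk' : ‖p - q‖ ≤ ‖q‖ / 2 := by
    refine le_of_sq_le_sq ?_ (by positivity)
    rw [hkn, hqn]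
    calc _ ≤ _ := hk
      _ = _ := by rw [hc]; ring
  have hq0 : q ≠ 0 := norm_pos_iff.1 (by rw [hqn]; positivity)
  have hpn : ‖q‖ / 2 ≤ ‖p‖ := by
    have := norm_sub_norm_le q p
    rw [norm_sub_rev] at this
    linarith
  have hp0 : p ≠ 0 := norm_pos_iff.1 (by have := norm_pos_iff.2 hq0; linarith)
  have hpq : 0 ≤ ⟪q, p⟫ := by
    have h1 : ⟪q, p⟫ = ‖q‖ ^ 2 + ⟪q, p - q⟫ := by
      rw [inner_sub_right, real_inner_self_eq_norm_sq]; ring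
    have h2 := neg_le_of_abs_le (abs_real_inner_le_norm q (p - q))
    nlinarith [norm_nonneg q]
  have hDx := hdiff x₀ hp0
  have hDy := hdiff y₀ hq0
  set D := 4 * h2 * d ^ 2 + c with hD
  obtain ⟨μ, hμ⟩ : ∃ μ, μ = 1 / (1 + ‖p‖ ^ 2) := ⟨_, rfl⟩
  obtain ⟨ν, hν⟩ : ∃ ν, ν = 1 / (1 + ‖q‖ ^ 2) := ⟨_, rfl⟩
  obtain ⟨m, hm⟩ : ∃ m, m = 2 / ‖q‖ ^ 2 - ν := ⟨_, rfl⟩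
  have hs0 : 0 < ‖q‖ ^ 2 := by positivity
  have hμ1 : 2 * μ - μ ^ 2 * ‖p‖ ^ 2 - μ ^ 2 = 1 / (1 + ‖p‖ ^ 2) := by
    rw [hμ]; field_simp; ring
  have hm1 : 2 * m - m ^ 2 * ‖q‖ ^ 2 - (-ν) ^ 2 = 1 / (1 + ‖q‖ ^ 2) := by
    rw [hm, hν]; field_simp; ring
  have tx := sum_frame_eq_mcOp hDx rfl hμ1
  have ty := sum_frame_eq_mcOp hDy rfl hm1
  rw [heq x₀ hp0] at tx
  rw [heq y₀ hq0] at ty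
  have hform : ∀ w, 4 * h2 * ⟪x₀ - y₀, w⟫ ^ 2 + c * ‖w‖ ^ 2
      = (D - c) / ‖q‖ ^ 2 * ⟪q, w⟫ ^ 2 + c * ‖w‖ ^ 2 := by
    intro w
    rw [hqn, hq, inner_smul_left, hD]
    simp only [conj_trivial]
    field_simp
    ring
  have hsum := Finset.sum_le_sum fun (k : Fin n) (_ : k ∈ Finset.univ) =>
    hsv hDx hDy (EuclideanSpace.single k 1 - (μ * p k) • p)
      (EuclideanSpace.single k 1 - (m * q k) • q)
  have hlast := hsv hDx hDy (μ • p) ((-ν) • q)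
  have e1 : ∀ k, EuclideanSpace.single k 1 - (μ * p k) • p
      - (EuclideanSpace.single k 1 - (m * q k) • q) = (m * q k) • q - (μ * p k) • p :=
    fun k => by abel
  have e2 : μ • p - (-ν) • q = μ • p + ν • q := by module
  have hfb := frame_difference_bound hq0 hpq hc0.le hconc hμ hν hm
  simp only [e1, hform] at hsum
  rw [Finset.sum_sub_distrib, Finset.sum_add_distrib, ← Finset.mul_sum,
    sum_norm_sq_sub_smul] at hsum
  rw [e2, hform, norm_smul, mul_pow, Real.norm_eq_abs, sq_abs] at hlast
  have htrace : 2 * K * (n - (2 * μ - μ ^ 2 * ‖p‖ ^ 2) * ‖p‖ ^ 2)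
      + 2 * K * (μ ^ 2 * ‖p‖ ^ 2) ≤ 2 * K * n := by
    have h0 : 0 ≤ 2 * K * (1 / (1 + ‖p‖ ^ 2) * ‖p‖ ^ 2) := by positivity
    rw [← hμ1] at h0
    linarith
  have hmain : 0 ≤ D / (1 + ‖q‖ ^ 2) + c * ‖p - q‖ ^ 2 / (1 + ‖p‖ ^ 2) + 2 * K * n := by
    linarith
  have hW : (1 + ‖q‖ ^ 2) / (1 + ‖p‖ ^ 2) ≤ 4 := by
    rw [div_le_iff₀ (by positivity)]
    nlinarith [pow_le_pow_left₀ (by positivity) hpn 2]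
  have hfin : 0 ≤ D + c * ‖p - q‖ ^ 2 * ((1 + ‖q‖ ^ 2) / (1 + ‖p‖ ^ 2))
      + 2 * K * n * (1 + ‖q‖ ^ 2) := by
    have := mul_nonneg hmain (by positivity : 0 ≤ 1 + ‖q‖ ^ 2)
    have e : (D / (1 + ‖q‖ ^ 2) + c * ‖p - q‖ ^ 2 / (1 + ‖p‖ ^ 2) + 2 * K * n) * (1 + ‖q‖ ^ 2)
      = D + c * ‖p - q‖ ^ 2 * ((1 + ‖q‖ ^ 2) / (1 + ‖p‖ ^ 2))
        + 2 * K * n * (1 + ‖q‖ ^ 2) := by field_simp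
    linarith
  have h4 := mul_le_mul_of_nonneg_left hW (by positivity : 0 ≤ c * ‖p - q‖ ^ 2)
  have e3 : ‖q‖ ^ 2 = 4 * h' (d ^ 2) ^ 2 * d ^ 2 := by rw [hqn, hc]; ring
  rw [← hkn, ← e3]
  have e4 : 8 * h' (d ^ 2) = c * 4 := by rw [hc]; ring
  rw [e4]
  linarith

theorem doubling_comparison (hu1 : ContDiff ℝ 1 u)
    (hu3 : ContDiffOn ℝ 3 u {x | gradient u x ≠ 0})
    (heq : ∀ x : EuclideanSpace ℝ (Fin n), gradient u x ≠ 0 → mcOp u x = 0)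
    (hK : 0 ≤ K) {R M : ℝ} {h'' : ℝ → ℝ} (hR : 0 < R)
    (hM : ∀ x, ‖x - z‖ ≤ 2 * R → |u x| ≤ M) (hMK : 2 * M ≤ K * R ^ 2) (hMh : 2 * M ≤ h (R ^ 2))
    (hcont : Continuous h) (hh : ∀ q > 0, HasDerivAt h (h' q) q)
    (hh2 : ∀ q > 0, HasDerivAt h' (h'' q) q) (h0 : ∀ q, 0 ≤ q → q ≤ R ^ 2 → 0 ≤ h q)
    (hcontact : ∀ x y, 0 < ‖x - y‖ → ‖x - y‖ < R → ‖x - z‖ < R →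
      h (‖x - y‖ ^ 2) + K * ‖x - z‖ ^ 2 < u x - u y →
      0 < h' (‖x - y‖ ^ 2) ∧
      (2 * K) ^ 2 * ‖x - z‖ ^ 2 ≤ h' (‖x - y‖ ^ 2) ^ 2 * ‖x - y‖ ^ 2 ∧
      4 * h'' (‖x - y‖ ^ 2) * ‖x - y‖ ^ 2 + 2 * h' (‖x - y‖ ^ 2) ≤ 0 ∧
      8 * h' (‖x - y‖ ^ 2) * ((2 * K) ^ 2 * ‖x - z‖ ^ 2)
        + 2 * K * n * (1 + 4 * h' (‖x - y‖ ^ 2) ^ 2 * ‖x - y‖ ^ 2)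
        < -(4 * h'' (‖x - y‖ ^ 2) * ‖x - y‖ ^ 2 + 2 * h' (‖x - y‖ ^ 2)))
    {y : EuclideanSpace ℝ (Fin n)} (hy : ‖z - y‖ ≤ R) : u z - u y ≤ h (‖z - y‖ ^ 2) := by
  by_contra! hlt
  set Z := fun P : EuclideanSpace ℝ (Fin n) × EuclideanSpace ℝ (Fin n) =>
      u P.1 - u P.2 - h (‖P.1 - P.2‖ ^ 2) - K * ‖P.1 - z‖ ^ 2 with hZ
  set S := {P : EuclideanSpace ℝ (Fin n) × EuclideanSpace ℝ (Fin n) |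
    ‖P.1 - z‖ ≤ R ∧ ‖P.1 - P.2‖ ≤ R}
  have hucont := hu1.continuous
  have hZc : Continuous Z := by fun_prop
  have hc1 : Continuous fun P : EuclideanSpace ℝ (Fin n) × EuclideanSpace ℝ (Fin n) =>
      ‖P.1 - z‖ := by fun_prop
  have hc2 : Continuous fun P : EuclideanSpace ℝ (Fin n) × EuclideanSpace ℝ (Fin n) =>
      ‖P.1 - P.2‖ := by fun_prop
  have hball : ∀ P ∈ S, ‖P.2 - z‖ ≤ 2 * R := by
    rintro P ⟨h1, h2⟩
    have := norm_sub_le_norm_sub_add_norm_sub P.2 P.1 z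
    rw [norm_sub_rev P.2 P.1] at this
    linarith
  have hSc : IsCompact S := by
    refine ((isCompact_closedBall z R).prod (isCompact_closedBall z (2 * R))).of_isClosed_subset
      ?_ fun P hP => ⟨?_, ?_⟩
    · exact (isClosed_le hc1 continuous_const).inter (isClosed_le hc2 continuous_const)
    · simpa [dist_eq_norm] using hP.1
    · simpa [dist_eq_norm] using hball P hP
  have hzy : (z, y) ∈ S := ⟨by simpa using hR.le, hy⟩
  obtain ⟨⟨x₀, y₀⟩, hP, hPmax⟩ := hSc.exists_isMaxOn ⟨_, hzy⟩ hZc.continuousOn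
  have hpos : 0 < Z (x₀, y₀) := by
    refine lt_of_lt_of_le ?_ (isMaxOn_iff.1 hPmax _ hzy)
    simp only [hZ, sub_self, norm_zero]
    linarith
  simp only [hZ] at hpos
  obtain ⟨hx1, hxy1⟩ : ‖x₀ - z‖ ≤ R ∧ ‖x₀ - y₀‖ ≤ R := hP
  have hosc : u x₀ - u y₀ ≤ 2 * M := by
    have h1 := (abs_le.1 (hM x₀ (by linarith))).2
    have h2 := (abs_le.1 (hM y₀ (hball (x₀, y₀) ⟨hx1, hxy1⟩))).1
    linarith
  have hh0 : 0 ≤ h (‖x₀ - y₀‖ ^ 2) := h0 _ (by positivity) (by gcongr)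
  have hx2 : ‖x₀ - z‖ < R := by
    refine lt_of_le_of_ne hx1 fun he => ?_
    rw [he] at hpos
    linarith
  have hKx : 0 ≤ K * ‖x₀ - z‖ ^ 2 := by positivity
  have hxy2 : ‖x₀ - y₀‖ < R := by
    refine lt_of_le_of_ne hxy1 fun he => ?_
    rw [he] at hpos
    linarith
  have hne : x₀ ≠ y₀ := by
    rintro rfl
    linarith
  have hd : 0 < ‖x₀ - y₀‖ := norm_pos_iff.2 (sub_ne_zero.2 hne)
  have hloc : IsLocalMax Z (x₀, y₀) := by
    refine hPmax.isLocalMax ?_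
    have hO : IsOpen {P : EuclideanSpace ℝ (Fin n) × EuclideanSpace ℝ (Fin n) |
        ‖P.1 - z‖ < R ∧ ‖P.1 - P.2‖ < R} :=
      (isOpen_lt hc1 continuous_const).inter (isOpen_lt hc2 continuous_const)
    exact Filter.mem_of_superset (hO.mem_nhds ⟨hx2, hxy2⟩) fun P hP => ⟨hP.1.le, hP.2.le⟩
  obtain ⟨c1, c2, c3, c4⟩ := hcontact x₀ y₀ hd hxy2 hx2 (by linarith)
  have := contact_inequality hu1 hu3 heq hK hne hloc hh (hh2 _ (by positivity)) c1 c2 c3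
  linarith

theorem holder_estimate (hu1 : ContDiff ℝ 1 u)
    (hu3 : ContDiffOn ℝ 3 u {x | gradient u x ≠ 0})
    (heq : ∀ x : EuclideanSpace ℝ (Fin n), gradient u x ≠ 0 → mcOp u x = 0)
    {R η : ℝ} (hR : 0 < R) (hη : 0 < η) (hηn : η * (100 * (n + 1)) ≤ 1)
    (hM : ∀ x, ‖x - z‖ ≤ 2 * R → |u x| ≤ η * R)
    {y : EuclideanSpace ℝ (Fin n)} (hy : ‖z - y‖ ≤ R) : u z - u y ≤ √(R * ‖z - y‖) := by
  have hn0 : (0 : ℝ) ≤ n := Nat.cast_nonneg n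
  have hη1 : η ≤ 1 / 100 := by nlinarith
  obtain ⟨ρ, hρ0, hρ⟩ : ∃ ρ : ℝ, 0 < ρ ∧ ρ ^ 2 = R := ⟨√R, by positivity, Real.sq_sqrt hR.le⟩
  have key : u z - u y ≤ ρ * (‖z - y‖ ^ 2) ^ (1 / 4 : ℝ) := by
    refine doubling_comparison (h := fun q => ρ * q ^ (1 / 4 : ℝ))
      (h' := fun q => ρ * (1 / 4 * q ^ (-3 / 4 : ℝ)))
      (h'' := fun q => ρ * (1 / 4 * (-3 / 4 * q ^ (-7 / 4 : ℝ)))) (K := 2 * η / R) (M := η * R)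
      hu1 hu3 heq (by positivity) hR hM ?_ ?_ ?_ ?_ ?_ ?_ ?_ hy
    · apply le_of_eq; field_simp
    · have : (R ^ 2) ^ (1 / 4 : ℝ) = ρ := by
        rw [← hρ, ← pow_mul, ← Real.rpow_natCast, ← Real.rpow_mul hρ0.le]
        norm_num
      simp only [this]
      nlinarith
    · exact continuous_const.mul (Real.continuous_rpow_const (by norm_num))
    · intro q hq
      have := (Real.hasDerivAt_rpow_const (x := q) (p := 1 / 4) (Or.inl hq.ne')).const_mul ρ
      norm_num at this ⊢
      exact this
    · intro q hq
      have := ((Real.hasDerivAt_rpow_const (x := q) (p := -3 / 4)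
        (Or.inl hq.ne')).const_mul (1 / 4)).const_mul ρ
      norm_num at this ⊢
      exact this
    · intro q hq _
      positivity
    · intro x y hd hdR hx _
      obtain ⟨t, ht0, ht⟩ : ∃ t : ℝ, 0 < t ∧ t ^ 2 = ‖x - y‖ :=
        ⟨√‖x - y‖, by positivity, Real.sq_sqrt hd.le⟩
      have e1 : (‖x - y‖ ^ 2) ^ (-3 / 4 : ℝ) = 1 / t ^ 3 := by
        rw [← ht, ← pow_mul, ← Real.rpow_natCast, ← Real.rpow_mul ht0.le, one_div,
          ← Real.rpow_natCast t 3, ← Real.rpow_neg ht0.le]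
        norm_num
      have e2 : (‖x - y‖ ^ 2) ^ (-7 / 4 : ℝ) = 1 / t ^ 7 := by
        rw [← ht, ← pow_mul, ← Real.rpow_natCast, ← Real.rpow_mul ht0.le, one_div,
          ← Real.rpow_natCast t 7, ← Real.rpow_neg ht0.le]
        norm_num
      have htρ : t < ρ := by
        rw [← ht, ← hρ] at hdR
        exact lt_of_pow_lt_pow_left₀ 2 hρ0.le hdR
      have hk : (2 * (2 * η / R)) ^ 2 * ‖x - z‖ ^ 2 ≤ 16 * η ^ 2 := by
        calc (2 * (2 * η / R)) ^ 2 * ‖x - z‖ ^ 2 ≤ (2 * (2 * η / R)) ^ 2 * R ^ 2 := by gcongr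
          _ = 16 * η ^ 2 := by field_simp; norm_num
      have hη2 : η ^ 2 ≤ 1 / 10000 := by nlinarith
      have hD : 4 * (ρ * (1 / 4 * (-3 / 4 * (1 / t ^ 7)))) * t ^ 4
          + 2 * (ρ * (1 / 4 * (1 / t ^ 3))) = -(1 / 4 * (ρ / t ^ 3)) := by
        field_simp; norm_num
      have hq : ‖x - y‖ ^ 2 = t ^ 4 := by rw [← ht]; ring
      simp only [e1, e2]
      rw [hq, hD]
      have hX : 0 < ρ / t ^ 3 := by positivity
      refine ⟨by positivity, hk.trans ?_, by linarith, ?_⟩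
      · have : (ρ * (1 / 4 * (1 / t ^ 3))) ^ 2 * t ^ 4 = 1 / 16 * (ρ / t) ^ 2 := by
          field_simp; norm_num
        rw [this]
        have h1 : 1 ≤ ρ / t := (one_le_div ht0).2 htρ.le
        nlinarith
      · have h1 : 8 * (ρ * (1 / 4 * (1 / t ^ 3))) * ((2 * (2 * η / R)) ^ 2 * ‖x - z‖ ^ 2)
            ≤ 8 * (ρ * (1 / 4 * (1 / t ^ 3))) * (16 * η ^ 2) := by gcongr
        have h2 : 8 * (ρ * (1 / 4 * (1 / t ^ 3))) * (16 * η ^ 2)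
            = 32 * η ^ 2 * (ρ / t ^ 3) := by ring
        have h3 : 2 * (2 * η / R) * n * (1 + 4 * (ρ * (1 / 4 * (1 / t ^ 3))) ^ 2 * t ^ 4)
            = η * n * (4 * (t / ρ) ^ 3 + t / ρ) * (ρ / t ^ 3) := by
          rw [← hρ]; field_simp; ring
        have h4 : t / ρ ≤ 1 := (div_le_one hρ0).2 htρ.le
        have h5 : (t / ρ) ^ 3 ≤ 1 := pow_le_one₀ (by positivity) h4
        have h6 : η * n * (4 * (t / ρ) ^ 3 + t / ρ) ≤ η * n * 5 := by
          gcongr; linarith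
        have h7 : 32 * η ^ 2 + η * n * (4 * (t / ρ) ^ 3 + t / ρ) < 1 / 4 := by nlinarith
        have h8 := mul_lt_mul_of_pos_right h7 hX
        rw [h3]
        linarith
  have e : (‖z - y‖ ^ 2) ^ (1 / 4 : ℝ) = √‖z - y‖ := by
    rw [← Real.rpow_natCast, ← Real.rpow_mul (norm_nonneg _), Real.sqrt_eq_rpow]
    norm_num
  rw [Real.sqrt_mul hR.le, ← hρ, Real.sqrt_sq hρ0.le, ← e]
  exact key

theorem gradient_estimate (hu1 : ContDiff ℝ 1 u)
    (hu3 : ContDiffOn ℝ 3 u {x | gradient u x ≠ 0})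
    (heq : ∀ x : EuclideanSpace ℝ (Fin n), gradient u x ≠ 0 → mcOp u x = 0)
    {R η ε : ℝ} (hR : 0 < R) (hη : 0 < η) (hε : 0 < ε) (hε1 : ε ≤ 1)
    (hηn : η * (1000 * (n + 1)) ≤ ε) (hM : ∀ x, ‖x - z‖ ≤ 3 * R → |u x| ≤ η * R)
    {y : EuclideanSpace ℝ (Fin n)} (hy : ‖z - y‖ ≤ R) : u z - u y ≤ ε * ‖z - y‖ := by
  have hn0 : (0 : ℝ) ≤ n := Nat.cast_nonneg n
  have hηε : η * 1000 ≤ ε := by nlinarith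
  obtain ⟨ρ, hρ0, hρ⟩ : ∃ ρ : ℝ, 0 < ρ ∧ ρ ^ 2 = R := ⟨√R, by positivity, Real.sq_sqrt hR.le⟩
  have hroot : ∀ q : ℝ, 0 ≤ q → ∃ t : ℝ, 0 ≤ t ∧ t ^ 4 = q ∧ q ^ (1 / 2 : ℝ) = t ^ 2 ∧
      q ^ (3 / 4 : ℝ) = t ^ 3 := by
    intro q hq
    refine ⟨q ^ (1 / 4 : ℝ), by positivity, ?_, ?_, ?_⟩ <;>
    · rw [← Real.rpow_natCast, ← Real.rpow_mul hq]; norm_num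
  have key : u z - u y ≤ ε * (‖z - y‖ ^ 2) ^ (1 / 2 : ℝ)
      - ε / (3 * ρ) * (‖z - y‖ ^ 2) ^ (3 / 4 : ℝ) := by
    refine doubling_comparison
      (h := fun q => ε * q ^ (1 / 2 : ℝ) - ε / (3 * ρ) * q ^ (3 / 4 : ℝ))
      (h' := fun q => ε * (1 / 2 * q ^ (-1 / 2 : ℝ)) - ε / (3 * ρ) * (3 / 4 * q ^ (-1 / 4 : ℝ)))
      (h'' := fun q => ε * (1 / 2 * (-1 / 2 * q ^ (-3 / 2 : ℝ)))
        - ε / (3 * ρ) * (3 / 4 * (-1 / 4 * q ^ (-5 / 4 : ℝ)))) (K := 2 * η / R) (M := η * R)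
      hu1 hu3 heq (by positivity) hR (fun x hx => hM x (by linarith)) ?_ ?_ ?_ ?_ ?_ ?_ ?_ hy
    · apply le_of_eq; field_simp
    · obtain ⟨t, ht0, ht, e1, e2⟩ := hroot (R ^ 2) (by positivity)
      have htρ : t = ρ := by
        rw [← hρ, ← pow_mul] at ht
        exact (pow_left_inj₀ ht0 hρ0.le (by norm_num)).1 ht
      simp only [e1, e2, htρ]
      have : ε / (3 * ρ) * ρ ^ 3 = ε * R / 3 := by rw [← hρ]; field_simp
      rw [this, hρ]
      nlinarith
    · exact (continuous_const.mul (Real.continuous_rpow_const (by norm_num))).sub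
        (continuous_const.mul (Real.continuous_rpow_const (by norm_num)))
    · intro q hq
      have := ((Real.hasDerivAt_rpow_const (x := q) (p := 1 / 2) (Or.inl hq.ne')).const_mul ε).sub
        ((Real.hasDerivAt_rpow_const (x := q) (p := 3 / 4)
          (Or.inl hq.ne')).const_mul (ε / (3 * ρ)))
      norm_num at this ⊢
      exact this
    · intro q hq
      have := (((Real.hasDerivAt_rpow_const (x := q) (p := -1 / 2)
        (Or.inl hq.ne')).const_mul (1 / 2)).const_mul ε).sub
        (((Real.hasDerivAt_rpow_const (x := q) (p := -1 / 4)
          (Or.inl hq.ne')).const_mul (3 / 4)).const_mul (ε / (3 * ρ)))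
      norm_num at this ⊢
      exact this
    · intro q hq hqR
      obtain ⟨t, ht0, ht, e1, e2⟩ := hroot q hq
      have htρ : t ≤ ρ := by
        rw [← hρ, ← ht, ← pow_mul] at hqR
        exact le_of_pow_le_pow_left₀ (by norm_num) hρ0.le hqR
      simp only [e1, e2]
      have : ε * t ^ 2 - ε / (3 * ρ) * t ^ 3 = ε * t ^ 2 * (1 - t / ρ / 3) := by field_simp
      rw [this]
      have h4 : t / ρ ≤ 1 := (div_le_one hρ0).2 htρ
      have : 0 ≤ 1 - t / ρ / 3 := by linarith
      positivity
    · intro x y hd hdR hx hpos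
      obtain ⟨t, ht0, ht⟩ : ∃ t : ℝ, 0 < t ∧ t ^ 2 = ‖x - y‖ :=
        ⟨√‖x - y‖, by positivity, Real.sq_sqrt hd.le⟩
      have hq : ‖x - y‖ ^ 2 = t ^ 4 := by rw [← ht]; ring
      have htρ : t < ρ := by
        rw [← ht, ← hρ] at hdR
        exact lt_of_pow_lt_pow_left₀ 2 hρ0.le hdR
      have h4 : t / ρ ≤ 1 := (div_le_one hρ0).2 htρ.le
      have hKx : 2 * η / R * ‖x - z‖ ^ 2 ≤ ρ * t := by
        have h1 : u x - u y ≤ √(R * ‖x - y‖) := by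
          refine holder_estimate hu1 hu3 heq hR hη ?_ (fun w hw => hM w ?_) hdR.le
          · nlinarith
          · have := norm_sub_le_norm_sub_add_norm_sub w x z
            linarith
        rw [← ht, ← hρ, ← mul_pow, Real.sqrt_sq (by positivity)] at h1
        obtain ⟨s, hs0, hs, e1, e2⟩ := hroot (‖x - y‖ ^ 2) (by positivity)
        have hst : s = t := by
          rw [hq] at hs
          exact (pow_left_inj₀ hs0 ht0.le (by norm_num)).1 hs
        have : 0 ≤ ε * t ^ 2 - ε / (3 * ρ) * t ^ 3 := by
          have e : ε * t ^ 2 - ε / (3 * ρ) * t ^ 3 = ε * t ^ 2 * (1 - t / ρ / 3) := by field_simp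
          rw [e]
          have : 0 ≤ 1 - t / ρ / 3 := by linarith
          positivity
        simp only [e1, e2, hst] at hpos
        rw [← hρ] at hpos ⊢
        linarith
      have e1 : (t ^ 4) ^ (-1 / 2 : ℝ) = 1 / t ^ 2 := by
        rw [← Real.rpow_natCast, ← Real.rpow_mul ht0.le, one_div,
          ← Real.rpow_natCast t 2, ← Real.rpow_neg ht0.le]
        norm_num
      have e2 : (t ^ 4) ^ (-1 / 4 : ℝ) = 1 / t := by
        rw [← Real.rpow_natCast, ← Real.rpow_mul ht0.le, one_div, ← Real.rpow_neg_one]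
        norm_num
      have e3 : (t ^ 4) ^ (-3 / 2 : ℝ) = 1 / t ^ 6 := by
        rw [← Real.rpow_natCast, ← Real.rpow_mul ht0.le, one_div,
          ← Real.rpow_natCast t 6, ← Real.rpow_neg ht0.le]
        norm_num
      have e4 : (t ^ 4) ^ (-5 / 4 : ℝ) = 1 / t ^ 5 := by
        rw [← Real.rpow_natCast, ← Real.rpow_mul ht0.le, one_div,
          ← Real.rpow_natCast t 5, ← Real.rpow_neg ht0.le]
        norm_num
      simp only [hq, e1, e2, e3, e4]
      obtain ⟨H, hH⟩ : ∃ H, H = ε * (1 / 2 * (1 / t ^ 2)) - ε / (3 * ρ) * (3 / 4 * (1 / t)) :=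
        ⟨_, rfl⟩
      have hH' : H = ε / (2 * t ^ 2) * (1 - t / ρ / 2) := by rw [hH]; field_simp; ring
      have hH1 : ε / (4 * t ^ 2) ≤ H := by
        have : ε / (4 * t ^ 2) = ε / (2 * t ^ 2) * (1 / 2) := by field_simp; norm_num
        rw [hH', this]
        gcongr; linarith
      have hH2 : H ≤ ε / (2 * t ^ 2) := by
        rw [hH']
        refine mul_le_of_le_one_right (by positivity) ?_
        have : 0 ≤ t / ρ := by positivity
        linarith
      have hH0 : 0 < H := lt_of_lt_of_le (by positivity) hH1
      have hD : 4 * (ε * (1 / 2 * (-1 / 2 * (1 / t ^ 6)))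
          - ε / (3 * ρ) * (3 / 4 * (-1 / 4 * (1 / t ^ 5)))) * t ^ 4 + 2 * H
          = -(ε / (4 * (ρ * t))) := by
        rw [hH]; field_simp; ring
      rw [← hH, hD]
      refine ⟨hH0, ?_, ?_, ?_⟩
      · calc (2 * (2 * η / R)) ^ 2 * ‖x - z‖ ^ 2 ≤ (2 * (2 * η / R)) ^ 2 * R ^ 2 := by gcongr
          _ = (4 * η) ^ 2 := by field_simp; norm_num
          _ ≤ (ε / 4) ^ 2 := by gcongr; linarith
          _ = (ε / (4 * t ^ 2)) ^ 2 * t ^ 4 := by field_simp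
          _ ≤ H ^ 2 * t ^ 4 := by gcongr
      · have : 0 < ε / (4 * (ρ * t)) := by positivity
        linarith
      · have h1 : 8 * H * ((2 * (2 * η / R)) ^ 2 * ‖x - z‖ ^ 2) ≤ 32 * ε * η * (1 / (ρ * t)) := by
          calc 8 * H * ((2 * (2 * η / R)) ^ 2 * ‖x - z‖ ^ 2)
              = 8 * H * (4 * (2 * η / R) * (2 * η / R * ‖x - z‖ ^ 2)) := by ring
            _ ≤ 8 * (ε / (2 * t ^ 2)) * (4 * (2 * η / R) * (ρ * t)) := by gcongr
            _ = 32 * ε * η * (1 / (ρ * t)) := by rw [← hρ]; field_simp; norm_num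
        have h2 : 4 * H ^ 2 * t ^ 4 ≤ 1 := by
          calc 4 * H ^ 2 * t ^ 4 ≤ 4 * (ε / (2 * t ^ 2)) ^ 2 * t ^ 4 := by gcongr
            _ = ε ^ 2 := by field_simp; norm_num
            _ ≤ 1 := pow_le_one₀ hε.le hε1
        have h3 : 2 * (2 * η / R) * n * (1 + 4 * H ^ 2 * t ^ 4) ≤ 8 * η * n * (1 / (ρ * t)) := by
          calc 2 * (2 * η / R) * n * (1 + 4 * H ^ 2 * t ^ 4)
              ≤ 2 * (2 * η / R) * n * (1 + 1) := by gcongr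
            _ = 8 * η * n * (1 / (ρ * ρ)) := by rw [← hρ]; field_simp; ring
            _ ≤ 8 * η * n * (1 / (ρ * t)) := by gcongr
        have h5 : 32 * ε * η + 8 * η * n < ε / 4 := by
          have : ε * η ≤ η := mul_le_of_le_one_left hη.le hε1
          nlinarith
        have h6 := mul_lt_mul_of_pos_right h5 (by positivity : 0 < 1 / (ρ * t))
        have h7 : ε / 4 * (1 / (ρ * t)) = ε / (4 * (ρ * t)) := by field_simp
        linarith
  have e : (‖z - y‖ ^ 2) ^ (1 / 2 : ℝ) = ‖z - y‖ := by
    rw [← Real.sqrt_eq_rpow, Real.sqrt_sq (norm_nonneg _)]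
  rw [e] at key
  have : 0 ≤ ε / (3 * ρ) * (‖z - y‖ ^ 2) ^ (3 / 4 : ℝ) := by positivity
  linarith

end Doubling

theorem eventually_abs_le_of_sublinear {u : EuclideanSpace ℝ (Fin n) → ℝ} (hu : Continuous u)
    (hgrowth : Filter.Tendsto (fun x : EuclideanSpace ℝ (Fin n) => |u x| / ‖x‖)
      (Filter.cocompact _) (𝓝 0)) (z : EuclideanSpace ℝ (Fin n)) {η : ℝ} (hη : 0 < η) :
    ∀ᶠ R in atTop, ∀ x, ‖x - z‖ ≤ 3 * R → |u x| ≤ η * R := by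
  have hev := hgrowth.eventually_lt_const (by positivity : 0 < η / 4)
  obtain ⟨S, hS, hSu⟩ := Filter.mem_cocompact.1 hev
  obtain ⟨C, hC⟩ := (hS.insert 0).exists_bound_of_continuousOn hu.continuousOn
  filter_upwards [eventually_ge_atTop (C / η), eventually_ge_atTop ‖z‖] with R hR1 hR2 x hx
  rw [div_le_iff₀ hη] at hR1
  by_cases hxS : x ∈ insert 0 S
  · have := hC x hxS
    rw [Real.norm_eq_abs] at this
    linarith
  · rw [Set.mem_insert_iff, not_or] at hxS
    have h1 : |u x| / ‖x‖ < η / 4 := hSu hxS.2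
    rw [div_lt_iff₀ (norm_pos_iff.2 hxS.1)] at h1
    have h2 : ‖x‖ ≤ 4 * R := by
      have := norm_le_norm_sub_add x z
      linarith
    nlinarith

end SecondVariation

/-- entire solutions of the minimal surface equation growing less than
linearly at infinity are constant. -/
theorem liouville_minimal_surface_sublinear (n : ℕ) (hn : 1 ≤ n)
    (u : EuclideanSpace ℝ (Fin n) → ℝ)
    (hu1 : ContDiff ℝ 1 u)
    (hu3 : ContDiffOn ℝ 3 u {x | gradient u x ≠ 0})
    (heq : ∀ x : EuclideanSpace ℝ (Fin n), gradient u x ≠ 0 → mcOp u x = 0)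
    (hgrowth : Filter.Tendsto (fun x : EuclideanSpace ℝ (Fin n) => |u x| / ‖x‖)
      (Filter.cocompact _) (nhds 0)) :
    ∃ c : ℝ, ∀ x, u x = c := by

  have hle : ∀ z y, u z ≤ u y := by
    intro z y
    have hε : ∀ ε : ℝ, 0 < ε → ε ≤ 1 → u z - u y ≤ ε * ‖z - y‖ := by
      intro ε hε0 hε1
      have hη : 0 < ε / (1000 * ((n : ℝ) + 1)) := by positivity
      obtain ⟨R, hR, hR0, hRy⟩ := ((eventually_abs_le_of_sublinear hu1.continuous hgrowth z hη).and
        ((eventually_gt_atTop 0).and (eventually_ge_atTop ‖z - y‖))).exists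
      exact gradient_estimate hu1 hu3 heq hR0 hη hε0 hε1
        (div_mul_cancel₀ ε (by positivity)).le hR hRy
    by_contra! hlt
    have h1 : 0 < u z - u y := sub_pos.2 hlt
    have h2 : 0 ≤ ‖z - y‖ := norm_nonneg _
    set δ := (u z - u y) / (u z - u y + ‖z - y‖ + 1) with hδ
    have h3 : δ * (u z - u y + ‖z - y‖ + 1) = u z - u y := div_mul_cancel₀ _ (by positivity)
    have h4 : 0 < δ := by positivity
    have h5 := hε δ h4 (by rw [hδ, div_le_one (by positivity)]; linarith)
    nlinarith
  exact ⟨u 0, fun x => le_antisymm (hle x 0) (hle 0 x)⟩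
end
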